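/- arXiv:2003.02344 — 3 statements merged into one kernel-verified Lean document; each statement's English description precedes it below -/
import Mathlib

section
/- Fix an integer N ≥ 2, β > 0 and a measurable potential V : ℝ → ℝ. Consider the (unnormalized) measure ν on ℝ^N × (0,∞)^{N−1} with density ∏_{n=1}^{N−1} b_n^{β(N−n)/2 − 1} · exp(−Tr V(J_{a,b})) with respect to Lebesgue measure in the variables (a_1,…,a_N, b_1,…,b_{N−1}), where V(J_{a,b}) is defined via the spectral theorem (equivalently Tr V(J_{a,b}) = Σ_{n=1}^N V(x_n) with x_1,…,x_N the eigenvalues of J_{a,b}). Then the pushforward of ν under the spectral map σ equals the measure on ℝ^N_> × S_N with density |Δ(x_1,…,x_N)|^β exp(−Σ_{n=1}^N V(x_n)) · ∏_{n=1}^N w_n^{β/2 − 1} (where w_N = 1 − Σ_{n=1}^{N−1} w_n) with respect to Lebesgue measure in (x_1,…,x_N, w_1,…,w_{N−1}). -/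
open MeasureTheory ProbabilityTheory Matrix Finset Real
open scoped ENNReal NNReal

noncomputable section

/-- The symmetric tridiagonal (Jacobi) matrix with diagonal `a` and
off-diagonal entries `√(b n)`. -/
def jacobiMatrix {N : ℕ} (a : Fin N → ℝ) (b : Fin (N - 1) → ℝ) :
    Matrix (Fin N) (Fin N) ℝ :=
  Matrix.of fun i j =>
    if i = j then a i
    else if h : (i : ℕ) + 1 = (j : ℕ) then
      Real.sqrt (b ⟨i, by have := j.isLt; omega⟩)
    else if h' : (j : ℕ) + 1 = (i : ℕ) then
      Real.sqrt (b ⟨j, by have := i.isLt; omega⟩)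
    else 0

lemma jacobiMatrix_isHermitian {N : ℕ} (a : Fin N → ℝ) (b : Fin (N - 1) → ℝ) :
    (jacobiMatrix a b).IsHermitian := by
  unfold Matrix.IsHermitian
  ext i j
  simp only [jacobiMatrix, Matrix.conjTranspose_apply, Matrix.of_apply, star_trivial]
  by_cases hij : i = j
  · subst hij; simp
  · have hji : j ≠ i := fun h => hij h.symm
    rw [if_neg hji, if_neg hij]
    by_cases h1 : (j : ℕ) + 1 = (i : ℕ)
    · have h2 : ¬((i : ℕ) + 1 = (j : ℕ)) := by omega
      rw [dif_pos h1, dif_neg h2, dif_pos h1]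
    · by_cases h2 : (i : ℕ) + 1 = (j : ℕ)
      · rw [dif_neg h1, dif_pos h2, dif_pos h2]
      · rw [dif_neg h1, dif_neg h2, dif_neg h2, dif_neg h1]

/-- Reordering of a finite tuple in decreasing order. -/
def sortDesc {N : ℕ} (v : Fin N → ℝ) : Fin N → ℝ :=
  fun i => v (Tuple.sort v (Fin.rev i))

/-- The eigenvalues of the Jacobi matrix `J_{a,b}`, in decreasing order. -/
def jacobiEigs {N : ℕ} (a : Fin N → ℝ) (b : Fin (N - 1) → ℝ) : Fin N → ℝ :=
  sortDesc (jacobiMatrix_isHermitian a b).eigenvalues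

/-- The squared first coordinates of unit eigenvectors of the Jacobi matrix `J_{a,b}`,
indexed compatibly with `jacobiEigs` (decreasing eigenvalue order):
`jacobiWeights hN a b i` is the squared first coordinate of a unit eigenvector
associated with the eigenvalue `jacobiEigs a b i`. -/
def jacobiWeights {N : ℕ} (hN : 0 < N) (a : Fin N → ℝ) (b : Fin (N - 1) → ℝ) :
    Fin N → ℝ :=
  fun i =>
    ((jacobiMatrix_isHermitian a b).eigenvectorBasis
        (Tuple.sort (jacobiMatrix_isHermitian a b).eigenvalues (Fin.rev i)) ⟨0, hN⟩) ^ 2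

/-- The spectral map: Jacobi data `(a, b)` is sent to the decreasingly ordered
eigenvalues together with the first `N - 1` spectral weights. -/
def spectralMap {N : ℕ} (hN : 0 < N) (a : Fin N → ℝ) (b : Fin (N - 1) → ℝ) :
    (Fin N → ℝ) × (Fin (N - 1) → ℝ) :=
  ⟨jacobiEigs a b, fun i => jacobiWeights hN a b ⟨i, by have := i.isLt; omega⟩⟩

/-- The Vandermonde product `∏_{i<j} (x j - x i)`. -/
def vdm {N : ℕ} (x : Fin N → ℝ) : ℝ :=
  ∏ i : Fin N, ∏ j ∈ Finset.Ioi i, (x j - x i)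

/-- The open chamber of decreasing vectors `x 0 > x 1 > … `. -/
def chamber (N : ℕ) : Set (Fin N → ℝ) := {x | ∀ i j : Fin N, i < j → x j < x i}

/-- The open simplex of positive weights with sum `< 1`. -/
def openSimplex (N : ℕ) : Set (Fin (N - 1) → ℝ) :=
  {w | (∀ i, 0 < w i) ∧ ∑ i, w i < 1}

/-- Extension of `N - 1` weights by the last weight `1 - ∑ w`. -/
def wExt {N : ℕ} (w : Fin (N - 1) → ℝ) : Fin N → ℝ :=
  fun n => if h : (n : ℕ) < N - 1 then w ⟨n, h⟩ else 1 - ∑ i, w i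

/-- The first `N` coordinates of a vector of length `2N - 1`. -/
def xPart {N : ℕ} (p : Fin (2 * N - 1) → ℝ) : Fin N → ℝ :=
  fun i => p ⟨i, by have := i.isLt; omega⟩

/-- The last `N - 1` coordinates of a vector of length `2N - 1`. -/
def wPart {N : ℕ} (p : Fin (2 * N - 1) → ℝ) : Fin (N - 1) → ℝ :=
  fun i => p ⟨N + i, by have := i.isLt; omega⟩

/-- The diagonal coefficients `a` built from the parameters `ξ`:
`a 1 = ξ 1`, `a n = ξ (2n-2) + ξ (2n-1)` (in one-based notation). -/
def xiToA {N : ℕ} (ξ : Fin (2 * N - 1) → ℝ) : Fin N → ℝ :=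
  fun n =>
    if h : (n : ℕ) = 0 then ξ ⟨0, by have := n.isLt; omega⟩
    else ξ ⟨2 * (n : ℕ) - 1, by have := n.isLt; omega⟩ +
      ξ ⟨2 * (n : ℕ), by have := n.isLt; omega⟩

/-- The off-diagonal coefficients `b` built from the parameters `ξ`:
`b n = ξ (2n-1) * ξ (2n)` (in one-based notation). -/
def xiToB {N : ℕ} (ξ : Fin (2 * N - 1) → ℝ) : Fin (N - 1) → ℝ :=
  fun n => ξ ⟨2 * (n : ℕ), by have := n.isLt; omega⟩ *
    ξ ⟨2 * (n : ℕ) + 1, by have := n.isLt; omega⟩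

/-- The chain-sequence parameters `ξ` built from canonical moments `c`:
`ξ 1 = c 1` and `ξ n = (1 - c (n-1)) * c n` (in one-based notation). -/
def cToXi {N : ℕ} (c : Fin (2 * N - 1) → ℝ) : Fin (2 * N - 1) → ℝ :=
  fun k =>
    if (k : ℕ) = 0 then c k
    else (1 - c ⟨(k : ℕ) - 1, by have := k.isLt; omega⟩) * c k

/-- The lower bidiagonal matrix `Ξ` with diagonal `√ξ 1, √ξ 3, …` and
subdiagonal `√ξ 2, √ξ 4, …` (in one-based notation). -/
def bidiag {N : ℕ} (ξ : Fin (2 * N - 1) → ℝ) : Matrix (Fin N) (Fin N) ℝ :=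
  Matrix.of fun i j =>
    if i = j then Real.sqrt (ξ ⟨2 * (i : ℕ), by have := i.isLt; omega⟩)
    else if h : (j : ℕ) + 1 = (i : ℕ) then
      Real.sqrt (ξ ⟨2 * (j : ℕ) + 1, by have := i.isLt; omega⟩)
    else 0

lemma mul_transpose_isHermitian {N : ℕ} (A : Matrix (Fin N) (Fin N) ℝ) :
    (A * Aᵀ).IsHermitian := by
  unfold Matrix.IsHermitian
  ext i j
  simp [Matrix.mul_apply, Matrix.conjTranspose_apply, Matrix.transpose_apply, mul_comm]

/-- Nonsymmetric tridiagonal matrix, similar to the Jacobi matrix. -/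
def tri {M : ℕ} (p : (Fin (M + 1) → ℝ) × (Fin M → ℝ)) :
    Matrix (Fin (M + 1)) (Fin (M + 1)) ℝ :=
  Matrix.of fun i j =>
    if i = j then p.1 i
    else if h : (i : ℕ) + 1 = (j : ℕ) then p.2 ⟨i, by have := j.isLt; omega⟩
    else if (j : ℕ) + 1 = (i : ℕ) then 1 else 0

/-- The diagonal conjugation. -/
def dg {M : ℕ} (b : Fin M → ℝ) (i : Fin (M + 1)) : ℝ :=
  ∏ k : Fin M, if (k : ℕ) < i then √(b k) else 1

lemma dg_zero {M : ℕ} (b : Fin M → ℝ) : dg b 0 = 1 := by simp [dg]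

lemma dg_succ {M : ℕ} (b : Fin M → ℝ) (i : Fin M) :
    dg b i.succ = √(b i) * dg b i.castSucc := by
  unfold dg
  rw [← Finset.mul_prod_erase _ _ (Finset.mem_univ i),
    ← Finset.mul_prod_erase (a := i) (f := fun k : Fin M => if (k : ℕ) < (i.castSucc : Fin (M+1)) then √(b k) else 1) _ (Finset.mem_univ i)]
  simp only [Fin.val_succ, Fin.val_castSucc, lt_add_iff_pos_right, zero_lt_one, if_true,
    lt_irrefl, if_false, one_mul]
  congr 1
  apply Finset.prod_congr rfl
  intro k hk
  have : (k : ℕ) ≠ i := fun h => (Finset.ne_of_mem_erase hk) (Fin.ext h)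
  congr 1
  simp only [eq_iff_iff]; omega

lemma dg_pos {M : ℕ} (b : Fin M → ℝ) (hb : ∀ i, 0 < b i) (i : Fin (M + 1)) : 0 < dg b i := by
  unfold dg
  apply Finset.prod_pos
  intro k _
  split_ifs
  · exact Real.sqrt_pos.2 (hb k)
  · exact one_pos

lemma dg_sq {M : ℕ} (b : Fin M → ℝ) (hb : ∀ i, 0 < b i) (i : Fin (M + 1)) :
    dg b i ^ 2 = ∏ k : Fin M, if (k : ℕ) < i then b k else 1 := by
  unfold dg
  rw [← Finset.prod_pow]
  apply Finset.prod_congr rfl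
  intro k _
  split_ifs
  · exact Real.sq_sqrt (hb k).le
  · simp

lemma conj_tri {M : ℕ} (p : (Fin (M + 1) → ℝ) × (Fin M → ℝ)) (hb : ∀ i, 0 < p.2 i) :
    diagonal (dg p.2) * tri p = jacobiMatrix (N := M + 1) p.1 p.2 * diagonal (dg p.2) := by
  ext i j
  rw [Matrix.diagonal_mul, Matrix.mul_diagonal]
  simp only [tri, jacobiMatrix, Matrix.of_apply]
  split_ifs with h1 h2 h3
  · subst h1; ring
  · have hi : (i : ℕ) < M := by have := j.isLt; omega
    have e1 : i = (⟨i, hi⟩ : Fin M).castSucc := rfl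
    have e2 : j = (⟨i, hi⟩ : Fin M).succ := by ext; simp [← h2]
    have := dg_succ p.2 ⟨i, hi⟩
    rw [← e1, ← e2] at this
    rw [this, ← mul_assoc, Real.mul_self_sqrt (hb _).le, mul_comm]
  · have hi : (j : ℕ) < M := by have := i.isLt; omega
    have e1 : j = (⟨j, hi⟩ : Fin M).castSucc := rfl
    have e2 : i = (⟨j, hi⟩ : Fin M).succ := by ext; simp [← h3]
    have := dg_succ p.2 ⟨j, hi⟩
    rw [← e1, ← e2] at this
    rw [this]; ring
  · simp

lemma conj_tri_pow {M : ℕ} (p : (Fin (M + 1) → ℝ) × (Fin M → ℝ)) (hb : ∀ i, 0 < p.2 i) (k : ℕ) :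
    diagonal (dg p.2) * tri p ^ k = jacobiMatrix (N := M + 1) p.1 p.2 ^ k * diagonal (dg p.2) := by
  induction k with
  | zero => simp
  | succ k ih =>
    rw [pow_succ, ← mul_assoc, ih, mul_assoc, conj_tri p hb, ← mul_assoc, ← pow_succ]

lemma conj_tri_pow_apply {M : ℕ} (p : (Fin (M + 1) → ℝ) × (Fin M → ℝ)) (hb : ∀ i, 0 < p.2 i)
    (k : ℕ) (i j : Fin (M + 1)) :
    dg p.2 i * (tri p ^ k) i j = (jacobiMatrix (N := M + 1) p.1 p.2 ^ k) i j * dg p.2 j := by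
  have := congrFun (congrFun (conj_tri_pow p hb k) i) j
  rwa [Matrix.diagonal_mul, Matrix.mul_diagonal] at this

lemma jac_pow_symm {M : ℕ} (p : (Fin (M + 1) → ℝ) × (Fin M → ℝ)) (k : ℕ) (i j : Fin (M + 1)) :
    (jacobiMatrix (N := M + 1) p.1 p.2 ^ k) i j = (jacobiMatrix (N := M + 1) p.1 p.2 ^ k) j i := by
  have := (jacobiMatrix_isHermitian (N := M + 1) p.1 p.2).pow k
  simpa using (this.apply i j).symm

lemma tri_pow_zero_zero {M : ℕ} (p : (Fin (M + 1) → ℝ) × (Fin M → ℝ)) (hb : ∀ i, 0 < p.2 i)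
    (k : ℕ) : (tri p ^ k) 0 0 = (jacobiMatrix (N := M + 1) p.1 p.2 ^ k) 0 0 := by
  have := conj_tri_pow_apply p hb k 0 0
  simpa [dg_zero] using this

lemma tri_pow_row {M : ℕ} (p : (Fin (M + 1) → ℝ) × (Fin M → ℝ)) (hb : ∀ i, 0 < p.2 i)
    (k : ℕ) (i : Fin (M + 1)) : (tri p ^ k) 0 i = dg p.2 i ^ 2 * (tri p ^ k) i 0 := by
  have h1 := conj_tri_pow_apply p hb k 0 i
  have h2 := conj_tri_pow_apply p hb k i 0
  rw [dg_zero] at h1 h2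
  rw [jac_pow_symm] at h1
  rw [mul_one] at h2
  rw [one_mul] at h1
  rw [h1, ← h2]; ring

lemma tri_pow_col {M : ℕ} (p : (Fin (M + 1) → ℝ) × (Fin M → ℝ)) (k : ℕ) :
    ∀ i : Fin (M + 1), (k < (i : ℕ) → (tri p ^ k) i 0 = 0) ∧ (k = (i : ℕ) → (tri p ^ k) i 0 = 1) := by
  induction k with
  | zero =>
    intro i
    refine ⟨fun h => ?_, fun h => ?_⟩
    · rw [pow_zero, Matrix.one_apply_ne]; rintro rfl; simp at h
    · have : i = 0 := Fin.ext h.symm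
      simp [this]
  | succ k ih =>
    intro i
    rw [pow_succ', Matrix.mul_apply]
    refine ⟨fun h => ?_, fun h => ?_⟩
    · apply Finset.sum_eq_zero
      intro j _
      by_cases hj : k < (j : ℕ)
      · rw [(ih j).1 hj, mul_zero]
      · have : tri p i j = 0 := by
          simp only [tri, Matrix.of_apply]
          rw [if_neg, dif_neg, if_neg]
          · omega
          · omega
          · rintro rfl; omega
        rw [this, zero_mul]
    · have hk : k < M + 1 := by have := i.isLt; omega
      rw [Finset.sum_eq_single ⟨k, hk⟩]
      · rw [(ih ⟨k, hk⟩).2 rfl, mul_one]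
        simp only [tri, Matrix.of_apply]
        rw [if_neg, dif_neg, if_pos]
        · exact h
        · omega
        · rintro rfl; simp at h
      · intro j _ hj
        have hj' : (j : ℕ) ≠ k := fun e => hj (Fin.ext e)
        by_cases hj2 : k < (j : ℕ)
        · rw [(ih j).1 hj2, mul_zero]
        · have : tri p i j = 0 := by
            simp only [tri, Matrix.of_apply]
            rw [if_neg, dif_neg, if_neg]
            · omega
            · omega
            · rintro rfl; omega
          rw [this, zero_mul]
      · simp

lemma tri_col_lt {M : ℕ} (p : (Fin (M + 1) → ℝ) × (Fin M → ℝ)) {k : ℕ} {i : Fin (M + 1)}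
    (h : k < (i : ℕ)) : (tri p ^ k) i 0 = 0 := (tri_pow_col p k i).1 h

lemma tri_col_eq {M : ℕ} (p : (Fin (M + 1) → ℝ) × (Fin M → ℝ)) (i : Fin (M + 1)) :
    (tri p ^ (i : ℕ)) i 0 = 1 := (tri_pow_col p _ i).2 rfl

lemma tri_row_lt {M : ℕ} (p : (Fin (M + 1) → ℝ) × (Fin M → ℝ)) (hb : ∀ i, 0 < p.2 i)
    {k : ℕ} {i : Fin (M + 1)} (h : k < (i : ℕ)) : (tri p ^ k) 0 i = 0 := by
  rw [tri_pow_row p hb, tri_col_lt p h, mul_zero]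

lemma tri_row_eq {M : ℕ} (p : (Fin (M + 1) → ℝ) × (Fin M → ℝ)) (hb : ∀ i, 0 < p.2 i)
    (i : Fin (M + 1)) : (tri p ^ (i : ℕ)) 0 i = dg p.2 i ^ 2 := by
  rw [tri_pow_row p hb, tri_col_eq, mul_one]

/-- injectivity of the moment map in Jacobi coordinates -/
lemma tri_injective {M : ℕ} (p q : (Fin (M + 1) → ℝ) × (Fin M → ℝ))
    (hp : ∀ i, 0 < p.2 i) (hq : ∀ i, 0 < q.2 i)
    (h : ∀ k, k ≤ 2 * M + 1 → (tri p ^ k) 0 0 = (tri q ^ k) 0 0) : p = q := by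
  -- row matrix and column matrix
  let L : (Fin (M + 1) → ℝ) × (Fin M → ℝ) → Matrix (Fin (M + 1)) (Fin (M + 1)) ℝ :=
    fun p => Matrix.of fun i j => (tri p ^ (i : ℕ)) 0 j
  let R : (Fin (M + 1) → ℝ) × (Fin M → ℝ) → Matrix (Fin (M + 1)) (Fin (M + 1)) ℝ :=
    fun p => Matrix.of fun i j => (tri p ^ (j : ℕ)) i 0
  have hLR : ∀ p, ∀ i j, (L p * R p) i j = (tri p ^ ((i : ℕ) + j)) 0 0 := by
    intro p i j
    rw [pow_add, Matrix.mul_apply, Matrix.mul_apply]; rfl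
  have hLTR : ∀ p, ∀ i j, (L p * tri p * R p) i j = (tri p ^ ((i : ℕ) + 1 + j)) 0 0 := by
    intro p i j
    rw [pow_add, Matrix.mul_apply, Matrix.mul_apply]
    apply Finset.sum_congr rfl
    intro k _
    congr 1
  have e1 : L p * R p = L q * R q := by
    ext i j; rw [hLR, hLR]; apply h; have := i.isLt; have := j.isLt; omega
  have e2 : L p * tri p * R p = L q * tri q * R q := by
    ext i j; rw [hLTR, hLTR]; apply h; have := i.isLt; have := j.isLt; omega
  have hRt : ∀ p, (R p).IsUpperTriangular := by
    intro p i j hij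
    exact tri_col_lt p hij
  have hRdet : ∀ p, (R p).det = 1 := by
    intro p
    rw [Matrix.det_of_isUpperTriangular (hRt p)]
    exact Finset.prod_eq_one fun i _ => tri_col_eq p i
  have hLt : ∀ p, (∀ i, 0 < p.2 i) → (L p).IsLowerTriangular := by
    intro p hp i j hij
    exact tri_row_lt p hp (by simpa using hij)
  have hLdet : ∀ p, (∀ i, 0 < p.2 i) → (L p).det ≠ 0 := by
    intro p hp
    rw [Matrix.det_of_isLowerTriangular _ (hLt p hp)]
    refine Finset.prod_ne_zero_iff.2 fun i _ => ?_
    change (tri p ^ (i : ℕ)) 0 i ≠ 0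
    rw [tri_row_eq p hp]
    exact pow_ne_zero _ (dg_pos _ hp _).ne'
  have uR : ∀ p, IsUnit (R p).det := fun p => by rw [hRdet]; exact isUnit_one
  have uL : ∀ p, (∀ i, 0 < p.2 i) → IsUnit (L p).det := fun p hp => (hLdet p hp).isUnit
  have := fun p => Matrix.invertibleOfIsUnitDet _ (uR p)
  have := Matrix.invertibleOfIsUnitDet _ (uL q hq)
  -- X = R p * (R q)⁻¹ = (L p)⁻¹ * L q
  have hX : (L q)⁻¹ * L p = R q * (R p)⁻¹ := by
    have : (L q)⁻¹ * (L p * R p) * (R p)⁻¹ = (L q)⁻¹ * (L q * R q) * (R p)⁻¹ := by rw [e1]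
    rw [Matrix.nonsing_inv_mul_cancel_left _ _ (uL q hq), ← Matrix.mul_assoc,
      Matrix.mul_nonsing_inv_cancel_right _ _ (uR p)] at this
    exact this
  have hup : (R q * (R p)⁻¹).IsUpperTriangular :=
    (hRt q).mul (Matrix.blockTriangular_inv_of_blockTriangular (hRt p))
  have hlow : (R q * (R p)⁻¹).IsLowerTriangular := by
    rw [← hX]
    exact Matrix.BlockTriangular.mul (Matrix.blockTriangular_inv_of_blockTriangular (hLt q hq)) (hLt p hp)
  have hdiag : R q = Matrix.diagonal (fun i => (R q * (R p)⁻¹) i i) * R p := by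
    have : R q * (R p)⁻¹ = Matrix.diagonal (fun i => (R q * (R p)⁻¹) i i) := by
      ext i j
      rcases lt_trichotomy i j with hij | hij | hij
      · rw [Matrix.diagonal_apply_ne _ hij.ne]; exact hlow (by simpa using hij)
      · subst hij; simp
      · rw [Matrix.diagonal_apply_ne _ hij.ne']; exact hup (by simpa using hij)
    rw [← this, Matrix.nonsing_inv_mul_cancel_right _ _ (uR p)]
  have hR : R q = R p := by
    have hd : ∀ i, (R q * (R p)⁻¹) i i = 1 := by
      intro i
      have := congrFun (congrFun hdiag i) i
      rw [Matrix.diagonal_mul] at this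
      change (tri q ^ (i : ℕ)) i 0 = _ * (tri p ^ (i : ℕ)) i 0 at this
      rw [tri_col_eq, tri_col_eq, mul_one] at this
      exact this.symm
    rw [hdiag]; simp [hd]
  have hL : L p = L q := by
    rw [hR] at e1
    have := congrArg (· * (R p)⁻¹) e1
    simpa [Matrix.mul_nonsing_inv_cancel_right _ _ (uR p)] using this
  have hT : tri p = tri q := by
    rw [hR, hL] at e2
    have := congrArg (· * (R p)⁻¹) e2
    simp only [Matrix.mul_nonsing_inv_cancel_right _ _ (uR p)] at this
    have := congrArg ((L q)⁻¹ * ·) this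
    simpa [Matrix.nonsing_inv_mul_cancel_left _ _ (uL q hq)] using this
  ext i
  · have := congrFun (congrFun hT i) i
    simpa [tri] using this
  · have := congrFun (congrFun hT i.castSucc) i.succ
    simpa [tri, Fin.ext_iff] using this

lemma herm_pow_spectral {N : ℕ} {A : Matrix (Fin N) (Fin N) ℝ} (hA : A.IsHermitian) (k : ℕ)
    (i j : Fin N) : (A ^ k) i j =
      ∑ n, hA.eigenvectorBasis n i * hA.eigenvalues n ^ k * hA.eigenvectorBasis n j := by
  conv_lhs => rw [hA.spectral_theorem, ← map_pow, Matrix.diagonal_pow]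
  rw [Unitary.conjStarAlgAut_apply, Matrix.mul_apply]
  apply Finset.sum_congr rfl
  intro n _
  rw [Matrix.mul_diagonal]
  simp [Matrix.star_apply]

/-- sorted eigenvectors -/
def sU {N : ℕ} (a : Fin N → ℝ) (b : Fin (N - 1) → ℝ) (i n : Fin N) : ℝ :=
  (jacobiMatrix_isHermitian a b).eigenvectorBasis
        (Tuple.sort (jacobiMatrix_isHermitian a b).eigenvalues (Fin.rev n)) i

lemma jac_pow_spectral {N : ℕ} (a : Fin N → ℝ) (b : Fin (N - 1) → ℝ) (k : ℕ)
    (i j : Fin N) : (jacobiMatrix a b ^ k) i j =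
      ∑ n, sU a b i n * jacobiEigs a b n ^ k * sU a b j n := by
  rw [herm_pow_spectral (jacobiMatrix_isHermitian a b)]
  exact (Equiv.sum_comp (Fin.revPerm.trans (Tuple.sort (jacobiMatrix_isHermitian a b).eigenvalues))
    (fun n => (jacobiMatrix_isHermitian a b).eigenvectorBasis n i *
      (jacobiMatrix_isHermitian a b).eigenvalues n ^ k *
      (jacobiMatrix_isHermitian a b).eigenvectorBasis n j)).symm

lemma jacobiEigs_antitone {N : ℕ} (a : Fin N → ℝ) (b : Fin (N - 1) → ℝ) :
    Antitone (jacobiEigs a b) := by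
  intro i j hij
  exact Tuple.monotone_sort (jacobiMatrix_isHermitian a b).eigenvalues (Fin.rev_le_rev.2 hij)

lemma weights_eq {M : ℕ} (a : Fin (M + 1) → ℝ) (b : Fin M → ℝ) (n : Fin (M + 1)) :
    jacobiWeights (N := M + 1) (Nat.succ_pos M) a b n = sU (N := M + 1) a b 0 n ^ 2 := rfl

lemma sum_weights {M : ℕ} (a : Fin (M + 1) → ℝ) (b : Fin M → ℝ) :
    ∑ n, jacobiWeights (N := M + 1) (Nat.succ_pos M) a b n = 1 := by
  have := jac_pow_spectral (N := M + 1) a b 0 0 0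
  simp only [pow_zero, Matrix.one_apply_eq, mul_one] at this
  rw [this]
  exact Finset.sum_congr rfl fun n _ => by rw [weights_eq, sq]

lemma moment_weights {M : ℕ} (a : Fin (M + 1) → ℝ) (b : Fin M → ℝ) (k : ℕ) :
    (jacobiMatrix (N := M + 1) a b ^ k) 0 0 =
    ∑ n, jacobiWeights (N := M + 1) (Nat.succ_pos M) a b n * jacobiEigs (N := M + 1) a b n ^ k := by
  rw [jac_pow_spectral (N := M + 1) a b k 0 0]
  exact Finset.sum_congr rfl fun n _ => by rw [weights_eq]; ring

lemma sU_det_sq {M : ℕ} (a : Fin (M + 1) → ℝ) (b : Fin M → ℝ) :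
    (Matrix.of (sU (N := M + 1) a b)).det ^ 2 = 1 := by
  have : Matrix.of (sU (N := M + 1) a b) * (Matrix.of (sU (N := M + 1) a b))ᵀ = 1 := by
    ext i j
    have := jac_pow_spectral (N := M + 1) a b 0 i j
    simp only [pow_zero, mul_one] at this
    rw [this, Matrix.mul_apply]; rfl
  have h := congrArg Matrix.det this
  rw [Matrix.det_mul, Matrix.det_transpose, Matrix.det_one] at h
  rw [sq, h]

lemma vdm_eq {N : ℕ} (x : Fin N → ℝ) : vdm x = (Matrix.vandermonde x).det := by
  rw [Matrix.det_vandermonde]; rfl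

lemma krylov_det {M : ℕ} (p : (Fin (M + 1) → ℝ) × (Fin M → ℝ)) (hb : ∀ i, 0 < p.2 i) :
    ∏ i, dg p.2 i = (Matrix.of (sU (N := M + 1) p.1 p.2)).det *
      (∏ n, sU (N := M + 1) p.1 p.2 0 n) * vdm (jacobiEigs (N := M + 1) p.1 p.2) := by
  have h1 : Matrix.diagonal (dg p.2) * Matrix.of (fun i j : Fin (M + 1) => (tri p ^ (j : ℕ)) i 0)
     = Matrix.of (sU (N := M + 1) p.1 p.2) * Matrix.diagonal (sU (N := M + 1) p.1 p.2 0) *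
      Matrix.vandermonde (jacobiEigs (N := M + 1) p.1 p.2) := by
    ext i j
    rw [Matrix.diagonal_mul, Matrix.of_apply, conj_tri_pow_apply p hb, dg_zero, mul_one,
      jac_pow_spectral, Matrix.mul_apply]
    apply Finset.sum_congr rfl
    intro n _
    rw [Matrix.mul_diagonal, Matrix.vandermonde_apply, Matrix.of_apply]; ring
  have h2 := congrArg Matrix.det h1
  rw [Matrix.det_mul, Matrix.det_mul, Matrix.det_mul, Matrix.det_diagonal, Matrix.det_diagonal,
    Matrix.det_of_isUpperTriangular (M := Matrix.of (fun i j : Fin (M + 1) => (tri p ^ (j : ℕ)) i 0)),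
    Finset.prod_eq_one (f := fun i => Matrix.of (fun i j : Fin (M + 1) => (tri p ^ (j : ℕ)) i 0) i i),
    mul_one, ← vdm_eq] at h2
  · exact h2
  · intro i _; exact tri_col_eq p i
  · intro i j hij; exact tri_col_lt p hij

lemma krylov_sq {M : ℕ} (p : (Fin (M + 1) → ℝ) × (Fin M → ℝ)) (hb : ∀ i, 0 < p.2 i) :
    ∏ i, dg p.2 i ^ 2 = (∏ n, jacobiWeights (N := M + 1) (Nat.succ_pos M) p.1 p.2 n) *
      vdm (jacobiEigs (N := M + 1) p.1 p.2) ^ 2 := by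
  rw [Finset.prod_pow, krylov_det p hb, mul_pow, mul_pow, sU_det_sq, one_mul, ← Finset.prod_pow]
  rfl

lemma weights_pos {M : ℕ} (p : (Fin (M + 1) → ℝ) × (Fin M → ℝ)) (hb : ∀ i, 0 < p.2 i)
    (n : Fin (M + 1)) : 0 < jacobiWeights (N := M + 1) (Nat.succ_pos M) p.1 p.2 n := by
  have h := krylov_sq p hb
  have h0 : ∏ i, dg p.2 i ^ 2 ≠ 0 :=
    Finset.prod_ne_zero_iff.2 fun i _ => pow_ne_zero _ (dg_pos _ hb i).ne'
  rw [h] at h0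
  have := Finset.prod_ne_zero_iff.1 (left_ne_zero_of_mul h0) n (Finset.mem_univ _)
  exact lt_of_le_of_ne (by rw [weights_eq]; positivity) this.symm

lemma eigs_chamber {M : ℕ} (p : (Fin (M + 1) → ℝ) × (Fin M → ℝ)) (hb : ∀ i, 0 < p.2 i) :
    StrictAnti (jacobiEigs (N := M + 1) p.1 p.2) := by
  have h := krylov_sq p hb
  have h0 : ∏ i, dg p.2 i ^ 2 ≠ 0 :=
    Finset.prod_ne_zero_iff.2 fun i _ => pow_ne_zero _ (dg_pos _ hb i).ne'
  rw [h, vdm_eq] at h0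
  have h1 : (Matrix.vandermonde (jacobiEigs (N := M + 1) p.1 p.2)).det ≠ 0 := by
    intro h; simp [h] at h0
  exact (jacobiEigs_antitone _ _).strictAnti_of_injective (Matrix.det_vandermonde_ne_zero_iff.1 h1)

lemma wExt_castSucc {M : ℕ} (w : Fin M → ℝ) (i : Fin M) :
    wExt (N := M + 1) w i.castSucc = w i := by
  simp [wExt]

lemma wExt_last {M : ℕ} (w : Fin M → ℝ) :
    wExt (N := M + 1) w (Fin.last M) = 1 - ∑ i, w i := by
  simp [wExt]

lemma sum_wExt {M : ℕ} (w : Fin M → ℝ) : ∑ n, wExt (N := M + 1) w n = 1 := by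
  rw [Fin.sum_univ_castSucc, wExt_last]
  simp only [wExt_castSucc]; ring

lemma wExt_spectral {M : ℕ} (p : (Fin (M + 1) → ℝ) × (Fin M → ℝ)) :
    wExt (N := M + 1) (spectralMap (N := M + 1) (Nat.succ_pos M) p.1 p.2).2
      = jacobiWeights (N := M + 1) (Nat.succ_pos M) p.1 p.2 := by
  have h : ∀ i : Fin M, wExt (N := M + 1) (spectralMap (N := M + 1) (Nat.succ_pos M) p.1 p.2).2 i.castSucc
      = jacobiWeights (N := M + 1) (Nat.succ_pos M) p.1 p.2 i.castSucc := fun i =>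
    wExt_castSucc (M := M) _ i
  ext n
  refine Fin.lastCases ?_ h n
  have h1 := sum_wExt (M := M) (spectralMap (N := M + 1) (Nat.succ_pos M) p.1 p.2).2
  have h2 := sum_weights p.1 p.2
  rw [← h2, Fin.sum_univ_castSucc, Fin.sum_univ_castSucc] at h1
  simpa [h] using h1

lemma spectral_mem {M : ℕ} (p : (Fin (M + 1) → ℝ) × (Fin M → ℝ)) (hb : ∀ i, 0 < p.2 i) :
    spectralMap (N := M + 1) (Nat.succ_pos M) p.1 p.2 ∈ chamber (M + 1) ×ˢ openSimplex (M + 1) := by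
  refine ⟨fun i j hij => eigs_chamber p hb hij, fun i => weights_pos p hb _, ?_⟩
  have h1 := wExt_last (M := M) (spectralMap (N := M + 1) (Nat.succ_pos M) p.1 p.2).2
  rw [wExt_spectral] at h1
  have := weights_pos p hb (Fin.last M)
  rw [h1] at this
  exact sub_pos.1 this

lemma quad_poly {M : ℕ} (x x' w w' : Fin (M + 1) → ℝ)
    (h : ∀ k, k ≤ 2 * M + 1 → ∑ n, w n * x n ^ k = ∑ n, w' n * x' n ^ k)
    (P : Polynomial ℝ) (hP : P.natDegree ≤ 2 * M + 1) :
    ∑ n, w n * P.eval (x n) = ∑ n, w' n * P.eval (x' n) := by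
  have key : ∀ x w : Fin (M + 1) → ℝ, ∑ n, w n * P.eval (x n) =
      ∑ k ∈ Finset.range (2 * M + 2), P.coeff k * ∑ n, w n * x n ^ k := by
    intro x w
    simp_rw [Polynomial.eval_eq_sum_range' (Nat.lt_succ_of_le hP), Finset.mul_sum]
    rw [Finset.sum_comm]
    refine Finset.sum_congr rfl fun k _ => Finset.sum_congr rfl fun n _ => by ring
  rw [key, key]
  refine Finset.sum_congr rfl fun k hk => ?_
  rw [h k (Nat.le_of_lt_succ (Finset.mem_range.1 hk))]

lemma quad_range {M : ℕ} (x x' w w' : Fin (M + 1) → ℝ) (hx : Function.Injective x)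
    (hw : ∀ n, 0 < w n)
    (h : ∀ k, k ≤ 2 * M + 1 → ∑ n, w n * x n ^ k = ∑ n, w' n * x' n ^ k) (i : Fin (M + 1)) :
    ∃ j, x' j = x i := by
  by_contra hcon
  push Not at hcon
  have := quad_poly x x' w w' h
    ((∏ j, (Polynomial.X - Polynomial.C (x' j))) *
      ∏ j ∈ Finset.univ.erase i, (Polynomial.X - Polynomial.C (x j))) (by
      refine (Polynomial.natDegree_mul_le).trans ?_
      rw [Polynomial.natDegree_prod_of_monic _ _ (fun j _ => Polynomial.monic_X_sub_C _),
        Polynomial.natDegree_prod_of_monic _ _ (fun j _ => Polynomial.monic_X_sub_C _)]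
      simp
      omega)
  rw [Finset.sum_eq_single i, Finset.sum_eq_zero] at this
  · simp only [Polynomial.eval_mul, Polynomial.eval_prod, Polynomial.eval_sub, Polynomial.eval_X,
      Polynomial.eval_C] at this
    rcases mul_eq_zero.1 this with h1 | h1
    · exact (hw i).ne' h1
    · rcases mul_eq_zero.1 h1 with h1 | h1
      · obtain ⟨j, _, hj⟩ := Finset.prod_eq_zero_iff.1 h1
        exact hcon j (sub_eq_zero.1 hj).symm
      · obtain ⟨j, hj', hj⟩ := Finset.prod_eq_zero_iff.1 h1
        exact (Finset.ne_of_mem_erase hj') (hx (sub_eq_zero.1 hj)).symm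
  · intro n _
    rw [Polynomial.eval_mul, Polynomial.eval_prod, Finset.prod_eq_zero (Finset.mem_univ n)]
    · simp
    · simp
  · intro n _ hn
    rw [Polynomial.eval_mul, Polynomial.eval_prod, Polynomial.eval_prod,
      Finset.prod_eq_zero (s := Finset.univ.erase i) (Finset.mem_erase.2 ⟨hn, Finset.mem_univ n⟩)]
    · simp
    · simp
  · simp

lemma quad_inj {M : ℕ} (x x' w w' : Fin (M + 1) → ℝ) (hx : StrictAnti x) (hx' : StrictAnti x')
    (hw : ∀ n, 0 < w n) (hw' : ∀ n, 0 < w' n)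
    (h : ∀ k, k ≤ 2 * M + 1 → ∑ n, w n * x n ^ k = ∑ n, w' n * x' n ^ k) : x = x' ∧ w = w' := by
  have e : x = x' := by
    rw [← StrictAnti.range_inj hx hx']
    apply Set.Subset.antisymm
    · rintro _ ⟨i, rfl⟩
      exact quad_range x x' w w' hx.injective hw h i
    · rintro _ ⟨i, rfl⟩
      exact quad_range x' x w' w hx'.injective hw' (fun k hk => (h k hk).symm) i
  subst e
  refine ⟨rfl, ?_⟩
  ext i
  have := quad_poly x x w w' h
      (∏ j ∈ Finset.univ.erase i, (Polynomial.X - Polynomial.C (x j))) (by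
      rw [Polynomial.natDegree_prod_of_monic _ _ (fun j _ => Polynomial.monic_X_sub_C _)]
      simp
      omega)
  have hz : ∀ n, n ≠ i → Polynomial.eval (x n)
      (∏ j ∈ Finset.univ.erase i, (Polynomial.X - Polynomial.C (x j))) = 0 := by
    intro n hn
    rw [Polynomial.eval_prod,
      Finset.prod_eq_zero (s := Finset.univ.erase i) (Finset.mem_erase.2 ⟨hn, Finset.mem_univ n⟩)]
    simp
  rw [Finset.sum_eq_single i (fun n _ hn => by rw [hz n hn, mul_zero]) (by simp),
    Finset.sum_eq_single i (fun n _ hn => by rw [hz n hn, mul_zero]) (by simp)] at this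
  refine mul_right_cancel₀ ?_ this
  rw [Polynomial.eval_prod]
  refine Finset.prod_ne_zero_iff.2 fun j hj => ?_
  simp only [Polynomial.eval_sub, Polynomial.eval_X, Polynomial.eval_C]
  exact sub_ne_zero.2 fun e => (Finset.ne_of_mem_erase hj) (hx.injective e).symm

/-- odd and even moments, from Jacobi data -/
def mapF {M : ℕ} (p : (Fin (M + 1) → ℝ) × (Fin M → ℝ)) : (Fin (M + 1) → ℝ) × (Fin M → ℝ) :=
  (fun i => (tri p ^ (2 * (i : ℕ) + 1)) 0 0, fun i => (tri p ^ (2 * (i : ℕ) + 1 + 1)) 0 0)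

/-- moments from nodes and weights -/
def momG {M : ℕ} (q : (Fin (M + 1) → ℝ) × (Fin M → ℝ)) (k : ℕ) : ℝ :=
  ∑ n, wExt (N := M + 1) q.2 n * q.1 n ^ k

/-- odd and even moments, from nodes and weights -/
def mapG {M : ℕ} (q : (Fin (M + 1) → ℝ) × (Fin M → ℝ)) : (Fin (M + 1) → ℝ) × (Fin M → ℝ) :=
  (fun i => momG q (2 * (i : ℕ) + 1), fun i => momG q (2 * (i : ℕ) + 1 + 1))

lemma all_moments {M : ℕ} (f g : ℕ → ℝ) (h0 : f 0 = g 0)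
    (h1 : ∀ i : Fin (M + 1), f (2 * (i : ℕ) + 1) = g (2 * (i : ℕ) + 1))
    (h2 : ∀ i : Fin M, f (2 * (i : ℕ) + 1 + 1) = g (2 * (i : ℕ) + 1 + 1)) :
    ∀ k, k ≤ 2 * M + 1 → f k = g k := by
  intro k hk
  rcases Nat.even_or_odd' k with ⟨c, rfl | rfl⟩
  · rcases c with _ | c
    · exact h0
    · exact h2 ⟨c, by omega⟩
  · exact h1 ⟨c, by omega⟩

lemma mapF_injOn {M : ℕ} :
    Set.InjOn (mapF (M := M)) {p : (Fin (M + 1) → ℝ) × (Fin M → ℝ) | ∀ i, 0 < p.2 i} := by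
  intro p hp q hq h
  refine tri_injective p q hp hq ?_
  exact all_moments (fun k => (tri p ^ k) 0 0) (fun k => (tri q ^ k) 0 0) (by simp)
    (fun i => congrFun (congrArg Prod.fst h) i) (fun i => congrFun (congrArg Prod.snd h) i)

lemma wExt_pos {M : ℕ} {w : Fin M → ℝ} (hw : w ∈ openSimplex (M + 1)) (n : Fin (M + 1)) :
    0 < wExt (N := M + 1) w n := by
  refine Fin.lastCases ?_ (fun i => ?_) n
  · rw [wExt_last]; exact sub_pos.2 hw.2
  · rw [wExt_castSucc]; exact hw.1 i

lemma mapG_injOn {M : ℕ} :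
    Set.InjOn (mapG (M := M)) (chamber (M + 1) ×ˢ openSimplex (M + 1)) := by
  intro p hp q hq h
  have := quad_inj p.1 q.1 (wExt (N := M + 1) p.2) (wExt (N := M + 1) q.2)
    (fun i j hij => hp.1 i j hij) (fun i j hij => hq.1 i j hij) (wExt_pos hp.2) (wExt_pos hq.2)
    (all_moments (momG p) (momG q) (by
      simp only [momG, pow_zero, mul_one]
      rw [sum_wExt, sum_wExt])
    (fun i => congrFun (congrArg Prod.fst h) i) (fun i => congrFun (congrArg Prod.snd h) i))
  refine Prod.ext this.1 ?_
  ext i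
  have := congrFun this.2 i.castSucc
  rwa [wExt_castSucc, wExt_castSucc] at this

lemma mapG_spectral {M : ℕ} (p : (Fin (M + 1) → ℝ) × (Fin M → ℝ)) (hb : ∀ i, 0 < p.2 i) :
    mapG (M := M) (spectralMap (N := M + 1) (Nat.succ_pos M) p.1 p.2) = mapF p := by
  have : ∀ k, momG (M := M) (spectralMap (N := M + 1) (Nat.succ_pos M) p.1 p.2) k = (tri p ^ k) 0 0 := by
    intro k
    rw [tri_pow_zero_zero p hb, moment_weights, momG, wExt_spectral]
    rfl
  refine Prod.ext ?_ ?_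
  · ext i; exact this _
  · ext i; exact this _

/-- Krylov vectors of the multiplication operator -/
def kry {M : ℕ} (x w : Fin (M + 1) → ℝ) (j : Fin (M + 1)) : EuclideanSpace ℝ (Fin (M + 1)) :=
  WithLp.toLp 2 fun n => √(w n) * x n ^ (j : ℕ)

/-- multiplication operator -/
def mulX {M : ℕ} (x : Fin (M + 1) → ℝ) :
    EuclideanSpace ℝ (Fin (M + 1)) →ₗ[ℝ] EuclideanSpace ℝ (Fin (M + 1)) where
  toFun u := WithLp.toLp 2 fun n => x n * u n
  map_add' u v := by ext n; simp; ring
  map_smul' c u := by ext n; simp; ring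

lemma inner_eq {M : ℕ} (u v : EuclideanSpace ℝ (Fin (M + 1))) :
    inner ℝ u v = ∑ n, u n * v n := by
  rw [PiLp.inner_apply]
  exact Finset.sum_congr rfl fun n _ => by simp [mul_comm]

lemma kry_li {M : ℕ} (x w : Fin (M + 1) → ℝ) (hx : Function.Injective x) (hw : ∀ n, 0 < w n) :
    LinearIndependent ℝ (kry x w) := by
  have h1 : LinearIndependent ℝ (fun j n : Fin (M + 1) => √(w n) * x n ^ (j : ℕ)) := by
    have := Matrix.linearIndependent_cols_of_det_ne_zero
      (A := Matrix.diagonal (fun n => √(w n)) * Matrix.vandermonde x) (by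
        rw [Matrix.det_mul, Matrix.det_diagonal]
        refine mul_ne_zero (Finset.prod_ne_zero_iff.2 fun n _ => (Real.sqrt_pos.2 (hw n)).ne') ?_
        exact Matrix.det_vandermonde_ne_zero_iff.2 hx)
    have e : (fun j n : Fin (M + 1) => √(w n) * x n ^ (j : ℕ)) =
        (Matrix.diagonal (fun n => √(w n)) * Matrix.vandermonde x).col := by
      ext j n
      simp [Matrix.col, Matrix.diagonal_mul, Matrix.vandermonde_apply]
    rw [e]
    exact this
  exact h1.map' (WithLp.linearEquiv 2 ℝ (Fin (M + 1) → ℝ)).symm.toLinearMap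
    (LinearEquiv.ker _)

lemma mulX_kry {M : ℕ} (x w : Fin (M + 1) → ℝ) (j : Fin M) :
    mulX x (kry x w j.castSucc) = kry x w j.succ := by
  ext n
  simp [mulX, kry]; ring

lemma mulX_symm {M : ℕ} (x : Fin (M + 1) → ℝ) (u v : EuclideanSpace ℝ (Fin (M + 1))) :
    inner ℝ u (mulX x v) = inner ℝ v (mulX x u) := by
  rw [inner_eq, inner_eq]
  exact Finset.sum_congr rfl fun n _ => by simp [mulX]; ring

lemma mulX_span {M : ℕ} (x w : Fin (M + 1) → ℝ) (j : Fin M) (u : EuclideanSpace ℝ (Fin (M + 1)))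
    (hu : u ∈ Submodule.span ℝ (kry x w '' Set.Iio j.castSucc)) :
    mulX x u ∈ Submodule.span ℝ (kry x w '' Set.Iio j.succ) := by
  induction hu using Submodule.span_induction with
  | mem u hu =>
    obtain ⟨i, hi, rfl⟩ := hu
    have hi' : (i : ℕ) < j := hi
    have hiM : (i : ℕ) < M := by have := j.isLt; omega
    have : mulX x (kry x w (⟨i, hiM⟩ : Fin M).castSucc) = kry x w (⟨i, hiM⟩ : Fin M).succ :=
      mulX_kry x w ⟨i, hiM⟩
    change mulX x (kry x w i) = _ at this
    rw [this]
    refine Submodule.subset_span ⟨_, ?_, rfl⟩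
    simp only [Set.mem_Iio, Fin.lt_def, Fin.val_succ]; omega
  | zero => simp
  | add u v _ _ hu hv => rw [map_add]; exact Submodule.add_mem _ hu hv
  | smul c u _ hu => rw [map_smul]; exact Submodule.smul_mem _ _ hu

open InnerProductSpace in
lemma gs_orth {M : ℕ} (x w : Fin (M + 1) → ℝ) (i : Fin (M + 1))
    (u : EuclideanSpace ℝ (Fin (M + 1)))
    (hu : u ∈ Submodule.span ℝ (kry x w '' Set.Iio i)) :
    inner ℝ (gramSchmidt ℝ (kry x w) i) u = 0 := by
  induction hu using Submodule.span_induction with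
  | mem u hu =>
    obtain ⟨j, hj, rfl⟩ := hu
    exact gramSchmidt_inv_triangular ℝ _ hj
  | zero => simp
  | add u v _ _ hu hv => rw [inner_add_right, hu, hv, add_zero]
  | smul c u _ hu => rw [inner_smul_right, hu, mul_zero]

open InnerProductSpace in
lemma gs_decomp {M : ℕ} (x w : Fin (M + 1) → ℝ) (i : Fin (M + 1)) :
    kry x w i - gramSchmidt ℝ (kry x w) i ∈ Submodule.span ℝ (kry x w '' Set.Iio i) := by
  rw [← span_gramSchmidt_Iio ℝ (kry x w) i, gramSchmidt_def' ℝ (kry x w) i, add_sub_cancel_left]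
  refine Submodule.sum_mem _ fun j hj => ?_
  rw [Submodule.starProjection_singleton]
  exact Submodule.smul_mem _ _ (Submodule.subset_span ⟨j, by simpa using hj, rfl⟩)

open InnerProductSpace in
lemma gs_mulX {M : ℕ} (x w : Fin (M + 1) → ℝ) (j : Fin M) :
    mulX x (gramSchmidt ℝ (kry x w) j.castSucc) - kry x w j.succ ∈
      Submodule.span ℝ (kry x w '' Set.Iio j.succ) := by
  have := mulX_span x w j _ (gs_decomp x w j.castSucc)
  rw [map_sub, mulX_kry] at this
  have := Submodule.neg_mem _ this
  rwa [neg_sub] at this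

open InnerProductSpace in
lemma gs_tri_zero {M : ℕ} (x w : Fin (M + 1) → ℝ) (i j : Fin (M + 1)) (hij : (j : ℕ) + 1 < i) :
    inner ℝ (gramSchmidt ℝ (kry x w) i) (mulX x (gramSchmidt ℝ (kry x w) j)) = 0 := by
  have hjM : (j : ℕ) < M := by have := i.isLt; omega
  have h := gs_mulX x w ⟨j, hjM⟩
  change mulX x (gramSchmidt ℝ (kry x w) j) - _ ∈ _ at h
  apply gs_orth
  rw [← sub_add_cancel (mulX x (gramSchmidt ℝ (kry x w) j)) (kry x w (⟨j, hjM⟩ : Fin M).succ)]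
  refine Submodule.add_mem _ (Submodule.span_mono (Set.image_mono ?_) h) (Submodule.subset_span ⟨_, ?_, rfl⟩)
  · intro k hk
    simp only [Set.mem_Iio, Fin.lt_def, Fin.val_succ] at hk ⊢; omega
  · simp only [Set.mem_Iio, Fin.lt_def, Fin.val_succ]; omega

open InnerProductSpace in
lemma gs_tri_pos {M : ℕ} (x w : Fin (M + 1) → ℝ) (hx : Function.Injective x) (hw : ∀ n, 0 < w n)
    (j : Fin M) : 0 <
    inner ℝ (gramSchmidt ℝ (kry x w) j.succ) (mulX x (gramSchmidt ℝ (kry x w) j.castSucc)) := by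
  have h1 := gs_orth x w _ _ (gs_mulX x w j)
  have h2 := gs_orth x w _ _ (gs_decomp x w j.succ)
  rw [inner_sub_right, sub_eq_zero] at h1 h2
  rw [h1, h2]
  exact real_inner_self_pos.2 (gramSchmidt_ne_zero _ (kry_li x w hx hw))

open InnerProductSpace in
lemma exists_jacobi {M : ℕ} (x w : Fin (M + 1) → ℝ) (hx : Function.Injective x)
    (hw : ∀ n, 0 < w n) (hs : ∑ n, w n = 1) :
    ∃ p : (Fin (M + 1) → ℝ) × (Fin M → ℝ), (∀ i, 0 < p.2 i) ∧
      ∀ k, (jacobiMatrix (N := M + 1) p.1 p.2 ^ k) 0 0 = ∑ n, w n * x n ^ k := by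
  set q := gramSchmidtNormed ℝ (kry x w) with hq
  have hli := kry_li x w hx hw
  have hon : Orthonormal ℝ q := gramSchmidtNormed_orthonormal hli
  have hnorm : ∀ i, 0 < (‖gramSchmidt ℝ (kry x w) i‖)⁻¹ := fun i =>
    inv_pos.2 (norm_pos_iff.2 (gramSchmidt_ne_zero _ hli))
  have hqd : ∀ i, q i = (‖gramSchmidt ℝ (kry x w) i‖)⁻¹ • gramSchmidt ℝ (kry x w) i := fun i => rfl
  have hzero : ∀ i j : Fin (M + 1), (j : ℕ) + 1 < i → inner ℝ (q i) (mulX x (q j)) = 0 := by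
    intro i j hij
    rw [hqd, hqd, map_smul, inner_smul_left, inner_smul_right, gs_tri_zero x w i j hij]; simp
  have hpos : ∀ j : Fin M, 0 < inner ℝ (q j.succ) (mulX x (q j.castSucc)) := by
    intro j
    rw [hqd, hqd, map_smul, real_inner_smul_left, real_inner_smul_right]
    exact mul_pos (hnorm _) (mul_pos (hnorm _) (gs_tri_pos x w hx hw j))
  let Q : Matrix (Fin (M + 1)) (Fin (M + 1)) ℝ := Matrix.of fun n i => q i n
  have hQ : Qᵀ * Q = 1 := by
    ext i j
    have := (orthonormal_iff_ite.1 hon) i j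
    rw [inner_eq] at this
    rw [Matrix.mul_apply, Matrix.one_apply, ← this]; rfl
  have hQ' : Q * Qᵀ = 1 := mul_eq_one_comm.1 hQ
  refine ⟨(fun i => inner ℝ (q i) (mulX x (q i)),
    fun i => (inner ℝ (q i.succ) (mulX x (q i.castSucc))) ^ 2), fun i => pow_pos (hpos i) 2, ?_⟩
  have hJ : jacobiMatrix (N := M + 1) (fun i => inner ℝ (q i) (mulX x (q i)))
    (fun i : Fin M => (inner ℝ (q i.succ) (mulX x (q i.castSucc))) ^ 2) =
      Qᵀ * Matrix.diagonal x * Q := by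
    have e : Qᵀ * Matrix.diagonal x * Q = Matrix.of fun i j => inner ℝ (q i) (mulX x (q j)) := by
      ext i j
      rw [Matrix.mul_apply, Matrix.of_apply, inner_eq]
      refine Finset.sum_congr rfl fun n _ => ?_
      rw [Matrix.mul_diagonal]
      simp [Q, mulX]; ring
    rw [e]
    ext i j
    simp only [jacobiMatrix, Matrix.of_apply]
    split_ifs with h1 h2 h3
    · subst h1; rfl
    · have hi : (i : ℕ) < M := by have := j.isLt; omega
      have e2 : j = (⟨i, hi⟩ : Fin M).succ := by ext; simp [← h2]
      change √((inner ℝ (q (⟨i, hi⟩ : Fin M).succ) (mulX x (q (⟨i, hi⟩ : Fin M).castSucc))) ^ 2) = _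
      rw [Real.sqrt_sq (hpos _).le, mulX_symm, ← e2]; rfl
    · have hi : (j : ℕ) < M := by have := i.isLt; omega
      have e2 : i = (⟨j, hi⟩ : Fin M).succ := by ext; simp [← h3]
      change √((inner ℝ (q (⟨j, hi⟩ : Fin M).succ) (mulX x (q (⟨j, hi⟩ : Fin M).castSucc))) ^ 2) = _
      rw [Real.sqrt_sq (hpos _).le, ← e2]; rfl
    · have h1' : (i : ℕ) ≠ j := fun e => h1 (Fin.ext e)
      by_cases hlt : (j : ℕ) < i
      · exact (hzero i j (by omega)).symm
      · rw [mulX_symm]; exact (hzero j i (by omega)).symm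
  have hJk : ∀ k : ℕ, (Qᵀ * Matrix.diagonal x * Q) ^ k = Qᵀ * Matrix.diagonal x ^ k * Q := by
    intro k
    induction k with
    | zero => simp [hQ]
    | succ k ih =>
      rw [pow_succ, ih, pow_succ]
      calc Qᵀ * diagonal x ^ k * Q * (Qᵀ * diagonal x * Q)
          = Qᵀ * diagonal x ^ k * (Q * Qᵀ) * diagonal x * Q := by simp only [Matrix.mul_assoc]
        _ = _ := by rw [hQ', Matrix.mul_one]; simp only [Matrix.mul_assoc]
  have hg0 : gramSchmidt ℝ (kry x w) 0 = kry x w 0 := gramSchmidt_bot ℝ (kry x w)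
  have hn0 : ‖kry x w 0‖ = 1 := by
    rw [EuclideanSpace.norm_eq]
    simp only [kry, Fin.val_zero, pow_zero, mul_one, Real.norm_eq_abs, sq_abs]
    rw [Real.sqrt_eq_one, ← hs]
    exact Finset.sum_congr rfl fun n _ => Real.sq_sqrt (hw n).le
  have hq0 : ∀ n, q 0 n = √(w n) := by
    intro n
    rw [hqd, hg0, hn0]
    simp [kry]
  intro k
  rw [hJ, hJk, Matrix.diagonal_pow, Matrix.mul_apply]
  refine Finset.sum_congr rfl fun n _ => ?_
  rw [Matrix.mul_diagonal]
  simp only [Matrix.transpose_apply, Q, Matrix.of_apply, hq0, Pi.pow_apply]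
  rw [mul_right_comm, Real.mul_self_sqrt (hw n).le]

lemma spectral_surj {M : ℕ} (q : (Fin (M + 1) → ℝ) × (Fin M → ℝ))
    (hq : q ∈ chamber (M + 1) ×ˢ openSimplex (M + 1)) :
    ∃ p : (Fin (M + 1) → ℝ) × (Fin M → ℝ), (∀ i, 0 < p.2 i) ∧
      spectralMap (N := M + 1) (Nat.succ_pos M) p.1 p.2 = q := by
  obtain ⟨p, hp, h⟩ := exists_jacobi q.1 (wExt (N := M + 1) q.2)
    (StrictAnti.injective fun i j hij => hq.1 i j hij) (wExt_pos hq.2) (sum_wExt q.2)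
  refine ⟨p, hp, ?_⟩
  refine mapG_injOn (spectral_mem p hp) hq ?_
  rw [mapG_spectral p hp]
  refine Prod.ext ?_ ?_
  · ext i; exact (tri_pow_zero_zero p hp _).trans (h _)
  · ext i; exact (tri_pow_zero_zero p hp _).trans (h _)

/-- linear part of `tri` -/
def dtri {M : ℕ} : ((Fin (M + 1) → ℝ) × (Fin M → ℝ)) →ₗ[ℝ]
    Matrix (Fin (M + 1)) (Fin (M + 1)) ℝ where
  toFun v := Matrix.of fun i j =>
    if i = j then v.1 i
    else if h : (i : ℕ) + 1 = (j : ℕ) then v.2 ⟨i, by have := j.isLt; omega⟩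
    else 0
  map_add' u v := by
    ext i j
    simp only [Matrix.of_apply, Matrix.add_apply, Prod.fst_add, Prod.snd_add, Pi.add_apply]
    split_ifs <;> simp
  map_smul' c u := by
    ext i j
    simp only [Matrix.of_apply, Matrix.smul_apply, Prod.smul_fst, Prod.smul_snd, Pi.smul_apply]
    split_ifs <;> simp

lemma tri_eq {M : ℕ} (p : (Fin (M + 1) → ℝ) × (Fin M → ℝ)) : tri p = tri 0 + dtri p := by
  ext i j
  simp only [tri, dtri, Matrix.add_apply, LinearMap.coe_mk, AddHom.coe_mk, Matrix.of_apply]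
  split_ifs <;> simp

lemma dtri_a {M : ℕ} (n : Fin (M + 1)) :
    dtri (M := M) (Pi.single n 1, 0) = Matrix.single n n 1 := by
  ext i j
  simp only [dtri, LinearMap.coe_mk, AddHom.coe_mk, Matrix.of_apply, Matrix.single_apply,
    Pi.single_apply, Pi.zero_apply]
  split_ifs <;> grind

lemma dtri_b {M : ℕ} (n : Fin M) :
    dtri (M := M) (0, Pi.single n 1) = Matrix.single n.castSucc n.succ 1 := by
  ext i j
  simp only [dtri, LinearMap.coe_mk, AddHom.coe_mk, Matrix.of_apply, Matrix.single_apply,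
    Pi.single_apply, Pi.zero_apply, Fin.ext_iff, Fin.val_castSucc, Fin.val_succ]
  split_ifs <;> grind

section deriv
attribute [local instance] Matrix.linftyOpNormedRing Matrix.linftyOpNormedAlgebra

lemma exists_fderiv {M : ℕ} (p : (Fin (M + 1) → ℝ) × (Fin M → ℝ)) (k : ℕ) :
    ∃ L : ((Fin (M + 1) → ℝ) × (Fin M → ℝ)) →L[ℝ] ℝ,
      HasFDerivAt (fun p => (tri p ^ k) 0 0) L p ∧
      ∀ v, L v = ∑ s ∈ Finset.range k, (tri p ^ (k - 1 - s) * dtri v * tri p ^ s) 0 0 := by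
  have h1 : HasFDerivAt (fun p => tri (M := M) p) (LinearMap.toContinuousLinearMap dtri) p := by
    have : (fun p => tri (M := M) p) = fun p => tri 0 + LinearMap.toContinuousLinearMap dtri p := by
      ext1 p; rw [tri_eq p]; rfl
    rw [this]
    exact (ContinuousLinearMap.hasFDerivAt _).const_add _
  have h2 := h1.fun_pow' k
  have h3 := (LinearMap.toContinuousLinearMap
    (Matrix.entryLinearMap ℝ ℝ (0 : Fin (M + 1)) (0 : Fin (M + 1)))).hasFDerivAt.comp p h2
  refine ⟨_, h3, fun v => ?_⟩
  have hsum : (∑ i ∈ range k, MulOpposite.op (tri p ^ i) • tri p ^ (k.pred - i) •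
      LinearMap.toContinuousLinearMap (dtri (M := M))) v =
      ∑ s ∈ Finset.range k, (tri p ^ (k - 1 - s) * dtri v * tri p ^ s) := by
    rw [_root_.sum_apply]; rfl
  exact (congrFun (congrFun hsum 0) 0).trans (Matrix.sum_apply 0 0 _ _)

end deriv

/-- derivative of moments -/
def dmom {M : ℕ} (p : (Fin (M + 1) → ℝ) × (Fin M → ℝ)) (k : ℕ) :
    ((Fin (M + 1) → ℝ) × (Fin M → ℝ)) →L[ℝ] ℝ := (exists_fderiv p k).choose

lemma dmom_hasFDerivAt {M : ℕ} (p : (Fin (M + 1) → ℝ) × (Fin M → ℝ)) (k : ℕ) :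
    HasFDerivAt (fun p => (tri p ^ k) 0 0) (dmom p k) p := (exists_fderiv p k).choose_spec.1

lemma dmom_apply {M : ℕ} (p : (Fin (M + 1) → ℝ) × (Fin M → ℝ)) (k : ℕ) (v) :
    dmom p k v = ∑ s ∈ Finset.range k, (tri p ^ (k - 1 - s) * dtri v * tri p ^ s) 0 0 :=
  (exists_fderiv p k).choose_spec.2 v

lemma mul_single_mul {n : ℕ} (A B : Matrix (Fin (n + 1)) (Fin (n + 1)) ℝ) (i j : Fin (n + 1)) :
    (A * (Matrix.single i j (1 : ℝ) : Matrix (Fin (n + 1)) (Fin (n + 1)) ℝ) * B) 0 0 = A 0 i * B j 0 := by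
  rw [Matrix.mul_apply, Finset.sum_eq_single j]
  · simp
  · intro b _ hb
    simp [Matrix.mul_single_apply_of_ne, hb]
  · simp

/-- rank of an index -/
def rk {M : ℕ} : Fin (M + 1) ⊕ Fin M → Fin (2 * M + 1) :=
  Sum.elim (fun i => ⟨2 * i, by have := i.isLt; omega⟩) (fun i => ⟨2 * i + 1, by have := i.isLt; omega⟩)

lemma rk_bij {M : ℕ} : Function.Bijective (rk (M := M)) := by
  rw [Fintype.bijective_iff_injective_and_card]
  constructor
  · rintro (i | i) (j | j) h <;> simp [rk, Fin.ext_iff] at h ⊢ <;> omega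
  · simp; omega

/-- rank equivalence -/
def rkE {M : ℕ} : Fin (M + 1) ⊕ Fin M ≃ Fin (2 * M + 1) := Equiv.ofBijective rk rk_bij

/-- the basis of the coordinate space -/
def bas (M : ℕ) : Module.Basis (Fin (M + 1) ⊕ Fin M) ℝ ((Fin (M + 1) → ℝ) × (Fin M → ℝ)) :=
  (Pi.basisFun ℝ (Fin (M + 1))).prod (Pi.basisFun ℝ (Fin M))

lemma bas_inl {M : ℕ} (i : Fin (M + 1)) : bas M (Sum.inl i) = (Pi.single i 1, 0) := by
  simp [bas, Module.Basis.prod_apply]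

lemma bas_inr {M : ℕ} (i : Fin M) : bas M (Sum.inr i) = (0, Pi.single i 1) := by
  simp [bas, Module.Basis.prod_apply]

lemma dmom_lt {M : ℕ} (p : (Fin (M + 1) → ℝ) × (Fin M → ℝ)) (hb : ∀ i, 0 < p.2 i)
    (k : ℕ) (c : Fin (M + 1) ⊕ Fin M) (h : k < rk c) : dmom p (k + 1) (bas M c) = 0 := by
  rw [dmom_apply]
  refine Finset.sum_eq_zero fun s hs => ?_
  rw [Finset.mem_range] at hs
  rcases c with n | n
  · rw [bas_inl, dtri_a, mul_single_mul]
    simp only [rk, Sum.elim_inl] at h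
    by_cases hsn : s < n
    · rw [tri_col_lt p hsn, mul_zero]
    · rw [tri_row_lt p hb (by omega), zero_mul]
  · rw [bas_inr, dtri_b, mul_single_mul]
    simp only [rk, Sum.elim_inr] at h
    by_cases hsn : s < n + 1
    · rw [tri_col_lt p (by simpa using hsn), mul_zero]
    · rw [tri_row_lt p hb (by simp; omega), zero_mul]

lemma dmom_a {M : ℕ} (p : (Fin (M + 1) → ℝ) × (Fin M → ℝ)) (hb : ∀ i, 0 < p.2 i)
    (n : Fin (M + 1)) : dmom p (2 * n + 1) (bas M (Sum.inl n)) = dg p.2 n ^ 2 := by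
  rw [dmom_apply, Finset.sum_eq_single (n : ℕ)]
  · rw [bas_inl, dtri_a, mul_single_mul, tri_col_eq, mul_one, ← tri_row_eq p hb,
      show 2 * (n : ℕ) + 1 - 1 - n = n by omega]
  · intro s hs hsn
    rw [Finset.mem_range] at hs
    rw [bas_inl, dtri_a, mul_single_mul]
    by_cases hsn : s < n
    · rw [tri_col_lt p hsn, mul_zero]
    · rw [tri_row_lt p hb (by omega), zero_mul]
  · intro h; simp at h; omega

lemma dmom_b {M : ℕ} (p : (Fin (M + 1) → ℝ) × (Fin M → ℝ)) (hb : ∀ i, 0 < p.2 i)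
    (n : Fin M) : dmom p (2 * n + 1 + 1) (bas M (Sum.inr n)) = dg p.2 n.castSucc ^ 2 := by
  rw [dmom_apply, Finset.sum_eq_single ((n.succ : Fin (M + 1)) : ℕ)]
  · rw [bas_inr, dtri_b, mul_single_mul, tri_col_eq, mul_one, ← tri_row_eq p hb,
      show 2 * (n : ℕ) + 1 + 1 - 1 - (n.succ : Fin (M + 1)) = (n.castSucc : Fin (M + 1)) by
        simp only [Fin.val_succ, Fin.val_castSucc]; omega]
  · intro s hs hsn
    rw [Finset.mem_range] at hs
    rw [bas_inr, dtri_b, mul_single_mul]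
    by_cases hsn : s < n + 1
    · rw [tri_col_lt p (by simpa using hsn), mul_zero]
    · rw [Fin.val_succ] at *
      rw [tri_row_lt p hb (by simp; omega), zero_mul]
  · intro h; simp at h; omega

/-- derivative of `mapF` -/
def dF {M : ℕ} (p : (Fin (M + 1) → ℝ) × (Fin M → ℝ)) :
    ((Fin (M + 1) → ℝ) × (Fin M → ℝ)) →L[ℝ] ((Fin (M + 1) → ℝ) × (Fin M → ℝ)) :=
  (ContinuousLinearMap.pi fun i : Fin (M + 1) => dmom p (2 * i + 1)).prod
    (ContinuousLinearMap.pi fun i : Fin M => dmom p (2 * i + 1 + 1))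

lemma mapF_hasFDerivAt {M : ℕ} (p : (Fin (M + 1) → ℝ) × (Fin M → ℝ)) :
    HasFDerivAt mapF (dF p) p := by
  refine HasFDerivAt.prodMk ?_ ?_
  · rw [hasFDerivAt_pi]; exact fun i => dmom_hasFDerivAt p _
  · rw [hasFDerivAt_pi]; exact fun i => dmom_hasFDerivAt p _

lemma det_eq_bas {M : ℕ} (L : ((Fin (M + 1) → ℝ) × (Fin M → ℝ)) →L[ℝ]
    ((Fin (M + 1) → ℝ) × (Fin M → ℝ))) :
    L.det = (Matrix.of fun r c => Sum.elim (L (bas M c)).1 (L (bas M c)).2 r).det := by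
  rw [ContinuousLinearMap.det, ← LinearMap.det_toMatrix (bas M)]
  congr 1
  ext r c
  rw [LinearMap.toMatrix_apply]
  rcases r with r | r <;> simp [bas]

lemma dF_det {M : ℕ} (p : (Fin (M + 1) → ℝ) × (Fin M → ℝ)) (hb : ∀ i, 0 < p.2 i) :
    (dF p).det = (∏ i, dg p.2 i ^ 2) * ∏ i : Fin M, dg p.2 i.castSucc ^ 2 := by
  have hent : ∀ r c, Sum.elim ((dF p) (bas M c)).1 ((dF p) (bas M c)).2 r
      = dmom p ((rk r : ℕ) + 1) (bas M c) := by
    rintro (r | r) c <;> rfl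
  rw [det_eq_bas]
  simp_rw [hent]
  rw [← Matrix.det_submatrix_equiv_self rkE.symm, Matrix.det_of_isLowerTriangular]
  · rw [← Equiv.prod_comp rkE, Fintype.prod_sum_type]
    congr 1
    · refine Finset.prod_congr rfl fun n _ => ?_
      rw [← dmom_a p hb n]; simp [rk]
    · refine Finset.prod_congr rfl fun n _ => ?_
      rw [← dmom_b p hb n]; simp [rk]
  · intro i j hij
    obtain ⟨r, rfl⟩ := rkE.surjective i
    obtain ⟨c, rfl⟩ := rkE.surjective j
    simp only [Matrix.submatrix_apply, Equiv.symm_apply_apply, Matrix.of_apply]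
    exact dmom_lt p hb _ _ hij

/-- linear part of `wExt` -/
def dwExt {M : ℕ} (n : Fin (M + 1)) : ((Fin (M + 1) → ℝ) × (Fin M → ℝ)) →ₗ[ℝ] ℝ where
  toFun v := if h : (n : ℕ) < M then v.2 ⟨n, h⟩ else - ∑ i, v.2 i
  map_add' u v := by
    split_ifs
    · simp
    · simp [Finset.sum_add_distrib]; ring
  map_smul' c u := by
    split_ifs
    · simp
    · simp [Finset.mul_sum]

lemma wExt_eq {M : ℕ} (q : (Fin (M + 1) → ℝ) × (Fin M → ℝ)) (n : Fin (M + 1)) :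
    wExt (N := M + 1) q.2 n = (if (n : ℕ) < M then 0 else 1) + dwExt n q := by
  simp only [wExt, dwExt, LinearMap.coe_mk, AddHom.coe_mk, Nat.add_sub_cancel]
  split_ifs
  · simp
  · exact sub_eq_add_neg _ _

lemma exists_fderivG {M : ℕ} (q : (Fin (M + 1) → ℝ) × (Fin M → ℝ)) (k : ℕ) :
    ∃ L : ((Fin (M + 1) → ℝ) × (Fin M → ℝ)) →L[ℝ] ℝ,
      HasFDerivAt (fun q => momG q k) L q ∧
      ∀ v, L v = ∑ n, (wExt (N := M + 1) q.2 n * (k * q.1 n ^ (k - 1) * v.1 n)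
        + q.1 n ^ k * dwExt n v) := by
  have h1 : ∀ n, HasFDerivAt (fun q : (Fin (M + 1) → ℝ) × (Fin M → ℝ) => wExt (N := M + 1) q.2 n)
      (LinearMap.toContinuousLinearMap (dwExt n)) q := by
    intro n
    have : (fun q : (Fin (M + 1) → ℝ) × (Fin M → ℝ) => wExt (N := M + 1) q.2 n) =
      fun q => (if (n : ℕ) < M then (0 : ℝ) else 1) + LinearMap.toContinuousLinearMap (dwExt n) q := by
      ext1 q; rw [wExt_eq q n]; rfl
    rw [this]
    exact (ContinuousLinearMap.hasFDerivAt _).const_add _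
  have h2 : ∀ n, HasFDerivAt (fun q : (Fin (M + 1) → ℝ) × (Fin M → ℝ) => q.1 n)
      ((ContinuousLinearMap.proj n : (Fin (M + 1) → ℝ) →L[ℝ] ℝ).comp
        (ContinuousLinearMap.fst ℝ (Fin (M + 1) → ℝ) (Fin M → ℝ))) q := fun n =>
    ContinuousLinearMap.hasFDerivAt ((ContinuousLinearMap.proj n : (Fin (M + 1) → ℝ) →L[ℝ] ℝ).comp
        (ContinuousLinearMap.fst ℝ (Fin (M + 1) → ℝ) (Fin M → ℝ)))
  have h3 := HasFDerivAt.fun_sum (u := Finset.univ) fun n _ => (h1 n).mul (HasFDerivAt.pow (h2 n) k)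
  refine ⟨_, h3, fun v => ?_⟩
  rw [_root_.sum_apply]
  refine Finset.sum_congr rfl fun n _ => ?_
  simp

/-- derivative of moments -/
def dmomG {M : ℕ} (p : (Fin (M + 1) → ℝ) × (Fin M → ℝ)) (k : ℕ) :
    ((Fin (M + 1) → ℝ) × (Fin M → ℝ)) →L[ℝ] ℝ := (exists_fderivG p k).choose

lemma dmomG_hasFDerivAt {M : ℕ} (p : (Fin (M + 1) → ℝ) × (Fin M → ℝ)) (k : ℕ) :
    HasFDerivAt (fun p => momG p k) (dmomG p k) p := (exists_fderivG p k).choose_spec.1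

lemma dmomG_apply {M : ℕ} (q : (Fin (M + 1) → ℝ) × (Fin M → ℝ)) (k : ℕ) (v) :
    dmomG q k v = ∑ n, (wExt (N := M + 1) q.2 n * (k * q.1 n ^ (k - 1) * v.1 n)
        + q.1 n ^ k * dwExt n v) :=
  (exists_fderivG q k).choose_spec.2 v

lemma dmomG_x {M : ℕ} (q : (Fin (M + 1) → ℝ) × (Fin M → ℝ)) (k : ℕ) (n : Fin (M + 1)) :
    dmomG q k (bas M (Sum.inl n)) = wExt (N := M + 1) q.2 n * (k * q.1 n ^ (k - 1)) := by
  rw [dmomG_apply, bas_inl, Finset.sum_eq_single n]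
  · simp [dwExt]
  · intro m _ hm
    simp [dwExt, hm]
  · simp

lemma dmomG_w {M : ℕ} (q : (Fin (M + 1) → ℝ) × (Fin M → ℝ)) (k : ℕ) (n : Fin M) :
    dmomG q k (bas M (Sum.inr n)) = q.1 n.castSucc ^ k - q.1 (Fin.last M) ^ k := by
  rw [dmomG_apply, bas_inr, Fin.sum_univ_castSucc, Finset.sum_eq_single n]
  · simp [dwExt]; ring
  · intro m _ hm
    simp [dwExt, hm]
  · simp

/-- derivative of `mapG` -/
def dG {M : ℕ} (p : (Fin (M + 1) → ℝ) × (Fin M → ℝ)) :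
    ((Fin (M + 1) → ℝ) × (Fin M → ℝ)) →L[ℝ] ((Fin (M + 1) → ℝ) × (Fin M → ℝ)) :=
  (ContinuousLinearMap.pi fun i : Fin (M + 1) => dmomG p (2 * i + 1)).prod
    (ContinuousLinearMap.pi fun i : Fin M => dmomG p (2 * i + 1 + 1))

lemma mapG_hasFDerivAt {M : ℕ} (p : (Fin (M + 1) → ℝ) × (Fin M → ℝ)) :
    HasFDerivAt mapG (dG p) p := by
  refine HasFDerivAt.prodMk ?_ ?_
  · rw [hasFDerivAt_pi]; exact fun i => dmomG_hasFDerivAt p _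
  · rw [hasFDerivAt_pi]; exact fun i => dmomG_hasFDerivAt p _

/-- degree minus one -/
def sd {M : ℕ} : Fin M ⊕ Fin (M + 1) → Fin (2 * M + 1) :=
  Sum.elim (fun i => ⟨i, by have := i.isLt; omega⟩) (fun i => ⟨M + i, by have := i.isLt; omega⟩)

lemma sd_bij {M : ℕ} : Function.Bijective (sd (M := M)) := by
  rw [Fintype.bijective_iff_injective_and_card]
  constructor
  · rintro (i | i) (j | j) h <;> simp [sd, Fin.ext_iff] at h ⊢ <;> omega
  · simp; omega

/-- degree equivalence -/
def sdE {M : ℕ} : Fin M ⊕ Fin (M + 1) ≃ Fin (2 * M + 1) := Equiv.ofBijective sd sd_bij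

open Polynomial in
/-- linear functionals -/
def fn {M : ℕ} (x : Fin (M + 1) → ℝ) : Fin M ⊕ Fin (M + 1) → (ℝ[X] →ₗ[ℝ] ℝ) :=
  Sum.elim (fun i => Polynomial.leval (x i.castSucc) - Polynomial.leval (x (Fin.last M)))
    (fun m => (Polynomial.leval (x m)).comp Polynomial.derivative)

lemma det_W {M : ℕ} (x : Fin (M + 1) → ℝ) :
    |(Matrix.of fun i j : Fin M => x i.castSucc ^ ((j : ℕ) + 1) - x (Fin.last M) ^ ((j : ℕ) + 1)).det|
      = |vdm x| := by
  let V' : Matrix (Fin (M + 1)) (Fin (M + 1)) ℝ := Matrix.of fun i j =>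
    Matrix.vandermonde x i j + (if i = Fin.last M then 0 else -1) * Matrix.vandermonde x (Fin.last M) j
  have h1 : V'.det = (Matrix.vandermonde x).det :=
    Matrix.det_eq_of_forall_row_eq_smul_add_const (fun i => if i = Fin.last M then 0 else -1)
      (Fin.last M) (by simp) (fun i j => rfl)
  rw [vdm_eq, ← h1, Matrix.det_succ_column V' 0, Finset.sum_eq_single (Fin.last M)]
  · simp only [V', Matrix.of_apply, Matrix.vandermonde_apply]
    simp only [if_true, Fin.val_zero, pow_zero, zero_mul, add_zero, mul_one, abs_mul, abs_pow,
      abs_neg, abs_one, one_pow, one_mul]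
    congr 2
    ext i j
    simp [Fin.castSucc_ne_last, sub_eq_add_neg]
  · intro i _ hi
    simp [V', hi, Matrix.vandermonde_apply]
  · simp

lemma prod_pairs {N : ℕ} (x : Fin N → ℝ) :
    |∏ m, ∏ j ∈ Finset.univ.erase m, (x m - x j)| = vdm x ^ 2 := by
  have h1 : ∀ m : Fin N, |∏ j ∈ Finset.univ.erase m, (x m - x j)| =
      (∏ j ∈ Finset.Ioi m, |x j - x m|) * ∏ j ∈ Finset.Iio m, |x m - x j| := by
    intro m
    have : Finset.univ.erase m = (Finset.Ioi m).disjUnion (Finset.Iio m)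
        (Finset.disjoint_left.2 fun a ha hb => by
          rw [Finset.mem_Ioi] at ha; rw [Finset.mem_Iio] at hb; exact lt_asymm ha hb) := by
      ext j
      simp only [Finset.mem_erase, Finset.mem_univ, and_true, Finset.mem_disjUnion,
        Finset.mem_Ioi, Finset.mem_Iio]
      constructor
      · intro h; exact (lt_or_gt_of_ne h).symm
      · rintro (h | h)
        · exact h.ne'
        · exact h.ne
    rw [this, Finset.prod_disjUnion, abs_mul, Finset.abs_prod, Finset.abs_prod]
    congr 1
    exact Finset.prod_congr rfl fun j _ => abs_sub_comm _ _
  rw [Finset.abs_prod]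
  simp_rw [h1]
  rw [Finset.prod_mul_distrib, ← sq_abs, sq]
  have h2 : |vdm x| = ∏ i, ∏ j ∈ Finset.Ioi i, |x j - x i| := by
    rw [vdm, Finset.abs_prod]
    exact Finset.prod_congr rfl fun i _ => Finset.abs_prod _ _
  rw [h2]
  congr 1
  exact Finset.prod_comm' (by simp)

open Polynomial in
lemma det_B {M : ℕ} (x : Fin (M + 1) → ℝ) :
    |(Matrix.of fun r d => fn x r (X ^ ((sd d : ℕ) + 1))).det| = vdm x ^ 4 := by
  set B : Matrix (Fin M ⊕ Fin (M + 1)) (Fin M ⊕ Fin (M + 1)) ℝ :=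
    Matrix.of fun r d => fn x r (X ^ ((sd d : ℕ) + 1)) with hB
  let P := Lagrange.nodal Finset.univ x
  have hPm : P.Monic := Lagrange.nodal_monic
  have hPd : P.natDegree = M + 1 := by simp [P, Lagrange.natDegree_nodal]
  let pol : Fin M ⊕ Fin (M + 1) → ℝ[X] := Sum.elim (fun j => X ^ ((j : ℕ) + 1)) (fun j => X ^ (j : ℕ) * P)
  have hdeg : ∀ c, (pol c).natDegree < 2 * M + 2 := by
    rintro (j | j)
    · simp only [pol, Sum.elim_inl, natDegree_X_pow]; omega
    · simp only [pol, Sum.elim_inr]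
      refine (natDegree_mul_le).trans_lt ?_
      rw [natDegree_X_pow, hPd]; omega
  let C : Matrix (Fin M ⊕ Fin (M + 1)) (Fin M ⊕ Fin (M + 1)) ℝ :=
    Matrix.of fun d c => (pol c).coeff ((sd d : ℕ) + 1)
  have hone : ∀ r, fn x r 1 = 0 := by
    rintro (i | i) <;> simp [fn]
  have hBC : B * C = Matrix.of fun r c => fn x r (pol c) := by
    ext r c
    rw [Matrix.mul_apply, Matrix.of_apply]
    conv_rhs => rw [(pol c).as_sum_range' _ (hdeg c)]
    rw [map_sum, Finset.sum_range_succ']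
    have : fn x r (monomial 0 ((pol c).coeff 0)) = 0 := by
      rw [← mul_one ((pol c).coeff 0), ← smul_eq_mul, ← smul_monomial, map_smul, monomial_zero_one, hone, smul_zero]
    rw [this, add_zero, Finset.sum_range, ← Equiv.sum_comp sdE]
    refine Finset.sum_congr rfl fun d _ => ?_
    simp only [B, C, Matrix.of_apply]
    rw [← C_mul_X_pow_eq_monomial, ← smul_eq_C_mul, map_smul, smul_eq_mul, mul_comm]
    rfl
  have hC : C.det = 1 := by
    rw [← Matrix.fromBlocks_toBlocks C]
    have h11 : C.toBlocks₁₁ = 1 := by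
      ext i j
      simp [C, pol, Matrix.toBlocks₁₁, sd, coeff_X_pow, Matrix.one_apply, Fin.ext_iff]
    have h21 : C.toBlocks₂₁ = 0 := by
      ext i j
      simp only [C, pol, Matrix.toBlocks₂₁, sd, coeff_X_pow, Matrix.of_apply, Sum.elim_inl, Sum.elim_inr, Matrix.zero_apply]
      rw [if_neg]; omega
    have h22 : C.toBlocks₂₂.IsUpperTriangular := by
      intro i j hij
      have hij' : (j : ℕ) < i := hij
      simp only [C, pol, Matrix.toBlocks₂₂, sd, Matrix.of_apply, Sum.elim_inr]
      rw [coeff_X_pow_mul', if_pos (by omega)]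
      apply coeff_eq_zero_of_natDegree_lt
      rw [hPd]; omega
    rw [h11, h21, Matrix.det_fromBlocks_zero₂₁, Matrix.det_one, one_mul,
      Matrix.det_of_isUpperTriangular h22]
    refine Finset.prod_eq_one fun i _ => ?_
    simp only [C, pol, Matrix.toBlocks₂₂, sd, Matrix.of_apply, Sum.elim_inr]
    rw [coeff_X_pow_mul', if_pos (by omega), show M + (i : ℕ) + 1 - i = M + 1 by omega, ← hPd]
    exact hPm
  have heq : B.det = (B * C).det := by rw [Matrix.det_mul, hC, mul_one]
  have hPz : ∀ m, P.eval (x m) = 0 := fun m => Lagrange.eval_nodal_at_node (Finset.mem_univ m)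
  have h12 : (B * C).toBlocks₁₂ = 0 := by
    rw [hBC]
    ext i j
    simp [Matrix.toBlocks₁₂, fn, pol, hPz]
  have h22 : (B * C).toBlocks₂₂ = Matrix.diagonal (fun m => ∏ j ∈ Finset.univ.erase m, (x m - x j)) *
      Matrix.vandermonde x := by
    rw [hBC]
    ext m j
    rw [Matrix.diagonal_mul, Matrix.vandermonde_apply]
    simp only [Matrix.toBlocks₂₂, fn, pol, Matrix.of_apply, Sum.elim_inr, LinearMap.comp_apply,
      Polynomial.leval_apply, Polynomial.derivative_mul, eval_add, eval_mul, hPz, mul_zero, zero_add]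
    rw [Lagrange.eval_nodal_derivative_eval_node_eq (Finset.mem_univ m), Lagrange.eval_nodal]
    simp [mul_comm]
  have h11 : (B * C).toBlocks₁₁ = Matrix.of fun i j : Fin M =>
      x i.castSucc ^ ((j : ℕ) + 1) - x (Fin.last M) ^ ((j : ℕ) + 1) := by
    rw [hBC]
    ext i j
    simp [Matrix.toBlocks₁₁, fn, pol]
  rw [heq, ← Matrix.fromBlocks_toBlocks (B * C), h12, Matrix.det_fromBlocks_zero₁₂, h22, h11,
    abs_mul, det_W, Matrix.det_mul, Matrix.det_diagonal, abs_mul, prod_pairs, ← vdm_eq]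
  rw [← sq_abs (vdm x), show vdm x ^ 4 = |vdm x| ^ 4 from ((by decide : Even 4).pow_abs _).symm]
  ring

lemma dG_det {M : ℕ} (q : (Fin (M + 1) → ℝ) × (Fin M → ℝ))
    (hw : ∀ n, 0 < wExt (N := M + 1) q.2 n) :
    |(dG q).det| = (∏ n, wExt (N := M + 1) q.2 n) * vdm q.1 ^ 4 := by
  have hent : ∀ r c, Sum.elim ((dG q) (bas M c)).1 ((dG q) (bas M c)).2 r
      = dmomG q ((rk r : ℕ) + 1) (bas M c) := by
    rintro (r | r) c <;> rfl
  rw [det_eq_bas]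
  simp_rw [hent]
  have h1 : (Matrix.of fun r c => dmomG q ((rk r : ℕ) + 1) (bas M c)) =
      ((Matrix.of fun r d => fn q.1 r (Polynomial.X ^ ((sd d : ℕ) + 1))).submatrix
        (Equiv.sumComm _ _) (rkE.trans sdE.symm))ᵀ *
        Matrix.diagonal (Sum.elim (wExt (N := M + 1) q.2) (fun _ => 1)) := by
    ext r c
    have hs : sd ((rkE.trans sdE.symm) r) = rk r := sdE.apply_symm_apply (rkE r)
    rw [Matrix.mul_diagonal, Matrix.transpose_apply, Matrix.submatrix_apply, Matrix.of_apply,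
      Matrix.of_apply, hs]
    rcases c with c | c
    · rw [dmomG_x]
      simp [fn]; ring
    · rw [dmomG_w]
      simp [fn]
  rw [h1, Matrix.det_mul, Matrix.det_transpose, abs_mul, Matrix.abs_det_submatrix_equiv_equiv, det_B,
    Matrix.det_diagonal, Fintype.prod_sum_type]
  simp only [Sum.elim_inl, Sum.elim_inr, Finset.prod_const_one, mul_one]
  rw [abs_of_pos (Finset.prod_pos fun n _ => hw n), mul_comm]

/-- change of variables through a common chart -/
lemma map_withDensity_chart {E : Type*} [NormedAddCommGroup E] [NormedSpace ℝ E]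
    [FiniteDimensional ℝ E] [MeasurableSpace E] [BorelSpace E] (μ : Measure E)
    [μ.IsAddHaarMeasure] {A B : Set E} (hA : MeasurableSet A) (hB : MeasurableSet B)
    {s F G : E → E} {F' G' : E → E →L[ℝ] E}
    (hF : ∀ p, HasFDerivAt F (F' p) p) (hG : ∀ p, HasFDerivAt G (G' p) p)
    (iF : Set.InjOn F A) (iG : Set.InjOn G B) (hs : ∀ p ∈ A, s p ∈ B)
    (hsurj : ∀ q ∈ B, ∃ p ∈ A, s p = q) (hGs : ∀ p ∈ A, G (s p) = F p)
    (hdet : ∀ q ∈ B, (G' q).det ≠ 0)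
    {f g : E → ℝ≥0∞}
    (hfg : ∀ p ∈ A, f p * ENNReal.ofReal |(G' (s p)).det| = ENNReal.ofReal |(F' p).det| * g (s p)) :
    Measure.map s (μ.withDensity (A.indicator f)) = μ.withDensity (B.indicator g) := by
  classical
  have himg : ∀ S : Set E, F '' (A ∩ s ⁻¹' S) = G '' (B ∩ S) := by
    intro S
    ext y
    constructor
    · rintro ⟨p, ⟨hp, hpS⟩, rfl⟩
      exact ⟨s p, ⟨hs p hp, hpS⟩, hGs p hp⟩
    · rintro ⟨q, ⟨hq, hqS⟩, rfl⟩
      obtain ⟨p, hp, rfl⟩ := hsurj q hq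
      exact ⟨p, ⟨hp, hqS⟩, (hGs p hp).symm⟩
  have hcF : Continuous F := continuous_iff_continuousAt.2 fun p => (hF p).continuousAt
  have hmeas : ∀ S : Set E, MeasurableSet S → MeasurableSet (A ∩ s ⁻¹' S) := by
    intro S hS
    have h1 : MeasurableSet (G '' (B ∩ S)) :=
      measurable_image_of_fderivWithin (hB.inter hS) (fun x _ => (hG x).hasFDerivWithinAt)
        (iG.mono Set.inter_subset_left)
    have h2 : A ∩ s ⁻¹' S = A ∩ F ⁻¹' (G '' (B ∩ S)) := by
      rw [← himg]
      ext p
      constructor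
      · rintro ⟨hp, hpS⟩; exact ⟨hp, p, ⟨hp, hpS⟩, rfl⟩
      · rintro ⟨hp, p', ⟨hp', hpS⟩, he⟩
        rw [← iF hp' hp he]; exact ⟨hp', hpS⟩
    rw [h2]
    exact hA.inter (hcF.measurable h1)
  have hae : AEMeasurable s (μ.withDensity (A.indicator f)) := by
    rw [withDensity_indicator hA]
    refine AEMeasurable.mono_ac ?_ (withDensity_absolutelyContinuous _ _)
    apply aemeasurable_restrict_of_measurable_subtype hA
    intro S hS
    have := measurable_subtype_coe (p := fun x => x ∈ A) (hmeas S hS)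
    convert this using 1
    ext x; simp
  set h : E → ℝ≥0∞ := fun y => g (Function.invFunOn G B y) /
    ENNReal.ofReal |(G' (Function.invFunOn G B y)).det| with hh
  have hinv : ∀ q ∈ B, Function.invFunOn G B (G q) = q := fun q hq =>
    iG.leftInvOn_invFunOn hq
  have hne : ∀ q ∈ B, ENNReal.ofReal |(G' q).det| ≠ 0 := fun q hq => by
    simpa using hdet q hq
  ext S hS
  rw [Measure.map_apply_of_aemeasurable hae hS, withDensity_indicator hA, withDensity_indicator hB,
    withDensity_apply _ hS, Measure.restrict_restrict hS, Set.inter_comm S B]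
  have e1 : ((μ.restrict A).withDensity f) (s ⁻¹' S) = ∫⁻ p in A ∩ s ⁻¹' S, f p ∂μ := by
    have hac := withDensity_absolutelyContinuous (μ.restrict A) f
    have hz : ((μ.restrict A).withDensity f) Aᶜ = 0 := hac (by
      rw [Measure.restrict_apply hA.compl]; simp)
    have : ((μ.restrict A).withDensity f) (s ⁻¹' S) =
        ((μ.restrict A).withDensity f) (A ∩ s ⁻¹' S) := by
      apply measure_congr
      have : ∀ᵐ x ∂((μ.restrict A).withDensity f), x ∈ A := hz
      filter_upwards [this] with x hx
      exact propext ⟨fun h => ⟨hx, h⟩, fun h => h.2⟩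
    rw [this, withDensity_apply _ (hmeas S hS), Measure.restrict_restrict (hmeas S hS)]
    congr 2
    ext x; simp only [Set.mem_inter_iff]; tauto
  rw [e1]
  have c1 := lintegral_image_eq_lintegral_abs_det_fderiv_mul μ (hmeas S hS)
    (fun x _ => (hF x).hasFDerivWithinAt) (iF.mono Set.inter_subset_left) h
  have c2 := lintegral_image_eq_lintegral_abs_det_fderiv_mul μ (hB.inter hS)
    (fun x _ => (hG x).hasFDerivWithinAt) (iG.mono Set.inter_subset_left) h
  rw [himg, c2] at c1
  have d1 : ∫⁻ p in A ∩ s ⁻¹' S, f p ∂μ =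
      ∫⁻ x in A ∩ s ⁻¹' S, ENNReal.ofReal |(F' x).det| * h (F x) ∂μ := by
    apply setLIntegral_congr_fun (hmeas S hS)
    intro p hp
    have hp := hp.1
    simp only [hh]
    rw [← hGs p hp, hinv _ (hs p hp), ← mul_div_assoc, ← hfg p hp,
      ENNReal.mul_div_cancel_right (hne _ (hs p hp)) ENNReal.ofReal_ne_top]
  have d2 : ∫⁻ q in B ∩ S, g q ∂μ =
      ∫⁻ x in B ∩ S, ENNReal.ofReal |(G' x).det| * h (G x) ∂μ := by
    apply setLIntegral_congr_fun (hB.inter hS)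
    intro q hq
    have hq := hq.1
    simp only [hh]
    rw [hinv _ hq, ENNReal.mul_div_cancel (hne _ hq) ENNReal.ofReal_ne_top]
  rw [d1, d2, c1]

lemma prod_dg_sq {M : ℕ} (b : Fin M → ℝ) (hb : ∀ i, 0 < b i) :
    ∏ i, dg b i ^ 2 = ∏ n : Fin M, b n ^ (M - (n : ℕ)) := by
  simp only [dg_sq b hb]
  rw [Finset.prod_comm]
  refine Finset.prod_congr rfl fun k _ => ?_
  rw [Finset.prod_ite, Finset.prod_const, Finset.prod_const_one, mul_one]
  congr 1
  have : Finset.univ.filter (fun i : Fin (M + 1) => (k : ℕ) < i) = Finset.Ioi k.castSucc := by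
    ext i; simp [Fin.lt_def]
  rw [this, Fin.card_Ioi]
  simp

lemma prod_b_rpow {M : ℕ} (b : Fin M → ℝ) (hb : ∀ i, 0 < b i) (β : ℝ) :
    (∏ n : Fin M, b n ^ (β / 2 * (((M + 1 : ℕ) : ℝ) - (((n : ℕ) : ℝ) + 1)) - 1)) * ∏ n, b n
      = (∏ i, dg b i ^ 2) ^ (β / 2) := by
  rw [prod_dg_sq b hb, ← Real.finsetProd_rpow _ _ (fun i _ => pow_nonneg (hb i).le _),
    ← Finset.prod_mul_distrib]
  refine Finset.prod_congr rfl fun n _ => ?_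
  rw [Real.rpow_sub_one (hb n).ne', div_mul_cancel₀ _ (hb n).ne', ← Real.rpow_natCast,
    ← Real.rpow_mul (hb n).le, Nat.cast_sub n.isLt.le]
  congr 1
  push_cast
  ring

lemma dF_det' {M : ℕ} (p : (Fin (M + 1) → ℝ) × (Fin M → ℝ)) (hb : ∀ i, 0 < p.2 i) :
    (dF p).det * ∏ i, p.2 i = (∏ i, dg p.2 i ^ 2) ^ 2 := by
  rw [dF_det p hb, sq (∏ i, dg p.2 i ^ 2), mul_assoc]
  congr 1
  rw [Fin.prod_univ_succ, ← Finset.prod_mul_distrib, dg_zero]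
  simp only [dg_succ, mul_pow, Real.sq_sqrt (hb _).le]
  simp [mul_comm]

lemma vdm_ne_zero {M : ℕ} {x : Fin (M + 1) → ℝ} (hx : x ∈ chamber (M + 1)) : vdm x ≠ 0 := by
  unfold vdm
  refine Finset.prod_ne_zero_iff.2 fun i _ => Finset.prod_ne_zero_iff.2 fun j hj => ?_
  exact (sub_neg.2 (hx i j (Finset.mem_Ioi.1 hj))).ne

lemma density_identity {M : ℕ} (β : ℝ) (V : ℝ → ℝ)
    (p : (Fin (M + 1) → ℝ) × (Fin M → ℝ)) (hb : ∀ i, 0 < p.2 i)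
    (q : (Fin (M + 1) → ℝ) × (Fin M → ℝ))
    (hq : spectralMap (N := M + 1) (Nat.succ_pos M) p.1 p.2 = q) :
    ((∏ n : Fin M, p.2 n ^ (β / 2 * (((M + 1 : ℕ) : ℝ) - (((n : ℕ) : ℝ) + 1)) - 1)) *
      Real.exp (-∑ n : Fin (M + 1), V (jacobiEigs (N := M + 1) p.1 p.2 n))) * |(dG q).det| =
    |(dF p).det| * (|vdm q.1| ^ β * Real.exp (-∑ n : Fin (M + 1), V (q.1 n)) *
      ∏ n : Fin (M + 1), wExt (N := M + 1) q.2 n ^ (β / 2 - 1)) := by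
  have hq1 : jacobiEigs (N := M + 1) p.1 p.2 = q.1 := by rw [← hq]; rfl
  have hm := spectral_mem p hb
  rw [hq] at hm
  have hw := fun n => wExt_pos hm.2 n
  have hk := krylov_sq p hb
  rw [← wExt_spectral, hq, hq1] at hk
  have hv := vdm_ne_zero hm.1
  have hdF := dF_det' p hb
  have hr := prod_b_rpow p.2 hb β
  have hB : 0 < ∏ i, p.2 i := Finset.prod_pos fun i _ => hb i
  have hW : 0 < ∏ n, wExt (N := M + 1) q.2 n := Finset.prod_pos fun i _ => hw i
  have hdF0 : 0 < (dF p).det := by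
    rw [dF_det p hb]
    exact mul_pos (Finset.prod_pos fun i _ => pow_pos (dg_pos _ hb i) _)
      (Finset.prod_pos fun i _ => pow_pos (dg_pos _ hb _) _)
  rw [dG_det q hw, abs_of_pos hdF0, hq1]
  have hg : (|vdm q.1| ^ β * ∏ n : Fin (M + 1), wExt (N := M + 1) q.2 n ^ (β / 2 - 1)) *
      (∏ n, wExt (N := M + 1) q.2 n) = (∏ i, dg p.2 i ^ 2) ^ (β / 2) := by
    rw [hk, Real.mul_rpow hW.le (sq_nonneg _), ← Real.finsetProd_rpow _ _ (fun i _ => (hw i).le),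
      mul_assoc, ← Finset.prod_mul_distrib, mul_comm]
    congr 1
    · refine Finset.prod_congr rfl fun n _ => ?_
      rw [Real.rpow_sub_one (hw n).ne', div_mul_cancel₀ _ (hw n).ne']
    · rw [← sq_abs, ← Real.rpow_natCast, ← Real.rpow_mul (abs_nonneg _)]
      congr 1; push_cast; ring
  rw [hk] at hdF
  rw [← hr] at hg
  generalize (∏ n : Fin M, p.2 n ^ (β / 2 * (((M + 1 : ℕ) : ℝ) - (((n : ℕ) : ℝ) + 1)) - 1)) = f at *
  generalize (∏ n : Fin (M + 1), wExt (N := M + 1) q.2 n ^ (β / 2 - 1)) = g at *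
  generalize (∏ n, wExt (N := M + 1) q.2 n) = W at *
  generalize (∏ i, p.2 i) = b at *
  generalize |vdm q.1| ^ β = v at *
  generalize Real.exp (-∑ n : Fin (M + 1), V (q.1 n)) = e
  apply mul_right_cancel₀ (mul_pos hB hW).ne'
  linear_combination (-e * W ^ 2 * vdm q.1 ^ 4) * hg - (v * g * e * W) * hdF

lemma measurable_pos (M : ℕ) :
    MeasurableSet {p : (Fin (M + 1) → ℝ) × (Fin M → ℝ) | ∀ i, 0 < p.2 i} := by
  rw [Set.ofPred_forall]
  refine MeasurableSet.iInter fun i => measurableSet_lt measurable_const ?_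
  fun_prop

lemma measurable_target (M : ℕ) :
    MeasurableSet (chamber (M + 1) ×ˢ openSimplex (M + 1)) := by
  refine MeasurableSet.prod ?_ ?_
  · unfold chamber
    simp only [Set.ofPred_forall]
    refine MeasurableSet.iInter fun i => MeasurableSet.iInter fun j => MeasurableSet.iInter fun _ =>
      measurableSet_lt ?_ ?_ <;> fun_prop
  · unfold openSimplex
    rw [Set.ofPred_and, Set.ofPred_forall]
    refine (MeasurableSet.iInter fun i => measurableSet_lt measurable_const ?_).inter
      (measurableSet_lt ?_ measurable_const) <;> fun_prop

lemma ofReal_indicator {E : Type*} (A : Set E) (f : E → ℝ) :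
    (fun p => ENNReal.ofReal (A.indicator f p)) = A.indicator fun p => ENNReal.ofReal (f p) := by
  classical
  ext1 p
  by_cases h : p ∈ A <;> simp [h]

/-- change of variables from Jacobi coefficients to nodes and weights. -/
theorem joint_distribution_recurrence_coefficients
    (N : ℕ) (hN : 2 ≤ N) (β : ℝ) (hβ : 0 < β) (V : ℝ → ℝ) (hV : Measurable V) :
    Measure.map
      (fun p : (Fin N → ℝ) × (Fin (N - 1) → ℝ) => spectralMap (by omega) p.1 p.2)
      ((volume : Measure ((Fin N → ℝ) × (Fin (N - 1) → ℝ))).withDensity fun p =>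
        ENNReal.ofReal (Set.indicator
          {p : (Fin N → ℝ) × (Fin (N - 1) → ℝ) | ∀ i, 0 < p.2 i}
          (fun p =>
            (∏ n : Fin (N - 1), p.2 n ^ (β / 2 * ((N : ℝ) - (((n : ℕ) : ℝ) + 1)) - 1)) *
              Real.exp (-∑ n : Fin N, V (jacobiEigs p.1 p.2 n))) p))
      = (volume : Measure ((Fin N → ℝ) × (Fin (N - 1) → ℝ))).withDensity fun q =>
          ENNReal.ofReal (Set.indicator (chamber N ×ˢ openSimplex N)
            (fun q => |vdm q.1| ^ β * Real.exp (-∑ n : Fin N, V (q.1 n)) *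
              ∏ n : Fin N, wExt q.2 n ^ (β / 2 - 1)) q) := by
  obtain ⟨M, rfl⟩ : ∃ M, N = M + 1 := ⟨N - 1, by omega⟩
  rw [ofReal_indicator, ofReal_indicator]
  have : (volume : Measure ((Fin (M + 1) → ℝ) × (Fin M → ℝ))).IsAddHaarMeasure :=
    Measure.prod.instIsAddHaarMeasure _ _
  refine map_withDensity_chart (E := (Fin (M + 1) → ℝ) × (Fin M → ℝ)) volume
    (measurable_pos M) (measurable_target M)
    (F := mapF) (G := mapG) (F' := dF) (G' := dG) mapF_hasFDerivAt mapG_hasFDerivAt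
    mapF_injOn mapG_injOn spectral_mem spectral_surj mapG_spectral ?_ ?_
  · intro q hq h0
    have hw := fun n => wExt_pos hq.2 n
    have h := dG_det q hw
    rw [h0, abs_zero] at h
    exact mul_ne_zero (Finset.prod_pos fun i _ => hw i).ne' (pow_ne_zero 4 (vdm_ne_zero hq.1)) h.symm
  · intro p hb
    have h := density_identity β V p hb _ rfl
    rw [← ENNReal.ofReal_mul' (abs_nonneg _), ← ENNReal.ofReal_mul (abs_nonneg _)]
    exact congrArg ENNReal.ofReal h
end
end

section
/- Fix an integer N ≥ 2. For every a ∈ ℝ^N and b ∈ (0,∞)^{N−1}, the Jacobi matrix J_{a,b} has N real simple eigenvalues x_1 > … > x_N, and the squared first coordinate w_n = (u_n)_1² of a unit eigenvector u_n associated with x_n is strictly positive for each n with Σ_{n=1}^N w_n = 1. Moreover, the spectral map σ : (a,b) ↦ (x_1,…,x_N, w_1,…,w_{N−1}) is a bijection from ℝ^N × (0,∞)^{N−1} onto ℝ^N_> × S_N (Favard's theorem for finitely supported measures). -/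
open MeasureTheory ProbabilityTheory Matrix Finset Real
open scoped ENNReal NNReal

noncomputable section

/-- Extension by zero of a finite tuple to all natural indices. -/
def favExt {M : ℕ} (u : Fin M → ℝ) : ℕ → ℝ := fun k => if h : k < M then u ⟨k, h⟩ else 0

lemma favExt_coe {M : ℕ} (u : Fin M → ℝ) (i : Fin M) : favExt u i = u i := by
  simp [favExt]

lemma favExt_lt {M : ℕ} (u : Fin M → ℝ) {k : ℕ} (h : k < M) : favExt u k = u ⟨k, h⟩ := by
  simp [favExt, h]

lemma favExt_ge {M : ℕ} (u : Fin M → ℝ) {k : ℕ} (h : M ≤ k) : favExt u k = 0 := by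
  simp [favExt, Nat.not_lt.mpr h]

lemma jacobi_entry {N : ℕ} (a : Fin N → ℝ) (b : Fin (N - 1) → ℝ) (i j : Fin N) :
    jacobiMatrix a b i j = (if (i : ℕ) = j then a i else 0)
      + (if (i : ℕ) + 1 = j then Real.sqrt (favExt b i) else 0)
      + (if (j : ℕ) + 1 = i then Real.sqrt (favExt b j) else 0) := by
  have hi := i.isLt
  have hj := j.isLt
  simp only [jacobiMatrix, Matrix.of_apply, Fin.ext_iff]
  split_ifs <;> first | omega | skip
  · simp
  · rw [favExt_lt b (by omega)]; simp
  · rw [favExt_lt b (by omega)]; simp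
  · simp

lemma sum_ite_val {N : ℕ} (u : Fin N → ℝ) (k : ℕ) (c : ℝ) :
    ∑ j : Fin N, (if k = (j : ℕ) then c * u j else 0) = c * favExt u k := by
  by_cases h : k < N
  · rw [Finset.sum_eq_single ⟨k, h⟩]
    · simp [favExt_lt u h]
    · intro j _ hj
      rw [if_neg]
      intro hk; apply hj; ext; exact hk.symm
    · simp
  · rw [favExt_ge u (by omega)]
    simp only [mul_zero]
    apply Finset.sum_eq_zero
    intro j _
    rw [if_neg]; have := j.isLt; omega

lemma jacobi_mulVec_zero {N : ℕ} (a : Fin N → ℝ) (b : Fin (N - 1) → ℝ) (u : Fin N → ℝ)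
    (hN : 0 < N) :
    (jacobiMatrix a b *ᵥ u) ⟨0, hN⟩ =
      favExt a 0 * favExt u 0 + Real.sqrt (favExt b 0) * favExt u 1 := by
  have : ∀ j : Fin N, jacobiMatrix a b ⟨0, hN⟩ j * u j =
      (if 0 = (j : ℕ) then favExt a 0 * u j else 0)
      + (if 1 = (j : ℕ) then Real.sqrt (favExt b 0) * u j else 0) := by
    intro j
    rw [jacobi_entry, favExt_lt a hN]
    simp [add_mul]
  simp only [Matrix.mulVec, dotProduct, this, Finset.sum_add_distrib, sum_ite_val]

lemma jacobi_mulVec_succ {N : ℕ} (a : Fin N → ℝ) (b : Fin (N - 1) → ℝ) (u : Fin N → ℝ)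
    (k : ℕ) (hk : k + 1 < N) :
    (jacobiMatrix a b *ᵥ u) ⟨k + 1, hk⟩ =
      Real.sqrt (favExt b k) * favExt u k + favExt a (k + 1) * favExt u (k + 1)
        + Real.sqrt (favExt b (k + 1)) * favExt u (k + 2) := by
  have : ∀ j : Fin N, jacobiMatrix a b ⟨k + 1, hk⟩ j * u j =
      (if k = (j : ℕ) then Real.sqrt (favExt b k) * u j else 0)
      + (if k + 1 = (j : ℕ) then favExt a (k + 1) * u j else 0)
      + (if k + 2 = (j : ℕ) then Real.sqrt (favExt b (k + 1)) * u j else 0) := by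
    intro j
    rw [jacobi_entry, favExt_lt a hk]
    simp only [add_left_inj, add_mul]
    have e : ((j : ℕ) = k) = (k = (j : ℕ)) := propext eq_comm
    simp only [e]
    split_ifs with h1 h2 h3 <;> first | omega | skip
    all_goals simp
    all_goals simp_all
  simp only [Matrix.mulVec, dotProduct, this, Finset.sum_add_distrib, sum_ite_val]

/-- An eigenvector of a Jacobi matrix with vanishing first coordinate is zero. -/
lemma jacobi_eigvec_zero {N : ℕ} (a : Fin N → ℝ) (b : Fin (N - 1) → ℝ) (hb : ∀ i, 0 < b i)
    (u : Fin N → ℝ) (t : ℝ) (hu : jacobiMatrix a b *ᵥ u = t • u)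
    (h0 : favExt u 0 = 0) : u = 0 := by
  have hS : ∀ k, k + 1 < N → 0 < Real.sqrt (favExt b k) := by
    intro k hk
    rw [favExt_lt b (by omega)]
    exact Real.sqrt_pos.mpr (hb _)
  have key : ∀ k, favExt u k = 0 ∧ favExt u (k + 1) = 0 := by
    intro k
    induction k with
    | zero =>
      refine ⟨h0, ?_⟩
      by_cases hk : 0 + 1 < N
      · have h1 := jacobi_mulVec_zero a b u (by omega)
        rw [hu] at h1
        simp only [Pi.smul_apply, smul_eq_mul, ← favExt_lt u, h0] at h1
        have := hS 0 hk
        simpa [this.ne'] using h1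
      · exact favExt_ge u (by omega)
    | succ k ih =>
      refine ⟨ih.2, ?_⟩
      by_cases hk : k + 1 + 1 < N
      · have h1 := jacobi_mulVec_succ a b u k (by omega)
        rw [hu] at h1
        simp only [Pi.smul_apply, smul_eq_mul, ← favExt_lt u, ih.1, ih.2] at h1
        have := hS (k + 1) hk
        simpa [this.ne'] using h1
      · exact favExt_ge u (by omega)
  ext i
  rw [← favExt_coe u i, (key i).1]
  rfl

/-- Uniqueness of the first coordinates: two eigenvectors are proportional. -/
lemma jacobi_eigvec_prop {N : ℕ} (hN : 0 < N) (a : Fin N → ℝ) (b : Fin (N - 1) → ℝ)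
    (hb : ∀ i, 0 < b i)
    (u v : Fin N → ℝ) (t : ℝ) (hu : jacobiMatrix a b *ᵥ u = t • u)
    (hv : jacobiMatrix a b *ᵥ v = t • v) (i : Fin N) :
    v ⟨0, hN⟩ * u i = u ⟨0, hN⟩ * v i := by
  have := jacobi_eigvec_zero a b hb (v ⟨0, hN⟩ • u - u ⟨0, hN⟩ • v) t
    (by rw [Matrix.mulVec_sub, Matrix.mulVec_smul, Matrix.mulVec_smul, hu, hv, smul_sub,
          smul_comm t, smul_comm t])
    (by rw [favExt_lt _ hN]; simp [mul_comm])
  have := congrFun this i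
  simp at this
  linarith

/-- Spectral data of a Jacobi matrix, with positive first coordinates. -/
lemma jacobi_spectral {N : ℕ} (hN : 0 < N) (a : Fin N → ℝ) (b : Fin (N - 1) → ℝ)
    (hb : ∀ i, 0 < b i) :
    StrictAnti (jacobiEigs a b) ∧ ∃ U : Matrix (Fin N) (Fin N) ℝ,
      (∀ n, jacobiMatrix a b *ᵥ U n = jacobiEigs a b n • U n) ∧ U * Uᵀ = 1 ∧
      (∀ n, 0 < U n ⟨0, hN⟩) ∧ (∀ n, jacobiWeights hN a b n = (U n ⟨0, hN⟩) ^ 2) := by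
  set hJ := jacobiMatrix_isHermitian a b with hJdef
  set s : Fin N → Fin N := fun n => Tuple.sort hJ.eigenvalues (Fin.rev n) with hs
  have hsinj : Function.Injective s := by
    intro p q h
    exact Fin.rev_injective ((Tuple.sort hJ.eigenvalues).injective h)
  let V : Matrix (Fin N) (Fin N) ℝ := fun n k => hJ.eigenvectorBasis (s n) k
  have hV : ∀ n, jacobiMatrix a b *ᵥ V n = jacobiEigs a b n • V n := by
    intro n
    exact hJ.mulVec_eigenvectorBasis (s n)
  have hVo : ∀ m n, V m ⬝ᵥ V n = if m = n then 1 else 0 := by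
    intro m n
    have := (orthonormal_iff_ite.mp hJ.eigenvectorBasis.orthonormal) (s m) (s n)
    rw [PiLp.inner_apply] at this
    simp only [hsinj.eq_iff] at this
    rw [← this]
    simp [dotProduct, V, mul_comm]
  have hV0 : ∀ n, V n ⟨0, hN⟩ ≠ 0 := by
    intro n h
    have h1 := jacobi_eigvec_zero a b hb (V n) _ (hV n) (by rw [favExt_lt _ hN]; exact h)
    have h2 := hVo n n
    rw [h1] at h2
    simp at h2
  have hinj : Function.Injective (jacobiEigs a b) := by
    intro m n h
    by_contra hmn
    have h1 := jacobi_eigvec_prop hN a b hb (V m) (V n) _ (hV m) (by rw [h]; exact hV n)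
    have h2 := hVo m n
    rw [if_neg hmn] at h2
    have h3 := hVo m m
    rw [if_pos rfl] at h3
    have h4 : V n ⟨0, hN⟩ * (V m ⬝ᵥ V m) = V m ⟨0, hN⟩ * (V m ⬝ᵥ V n) := by
      simp only [dotProduct, Finset.mul_sum]
      refine Finset.sum_congr rfl fun i _ => ?_
      linear_combination (V m i) * h1 i
    rw [h2, h3] at h4
    apply hV0 n
    simpa using h4
  have hanti : Antitone (jacobiEigs a b) := by
    intro p q hpq
    exact Tuple.monotone_sort hJ.eigenvalues (Fin.rev_le_rev.mpr hpq)
  refine ⟨hanti.strictAnti_of_injective hinj, ?_⟩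
  let e : Fin N → ℝ := fun n => if 0 < V n ⟨0, hN⟩ then 1 else -1
  have he : ∀ n, e n * e n = 1 := by
    intro n; simp only [e]; split_ifs <;> norm_num
  refine ⟨fun n => e n • V n, ?_, ?_, ?_, ?_⟩
  · intro n
    rw [Matrix.mulVec_smul, hV, smul_comm]
  · ext m n
    have h := hVo m n
    have h1 : ∑ j, (e m * V m j) * (e n * V n j) = (e m * e n) * ∑ j, V m j * V n j := by
      rw [Finset.mul_sum]
      exact Finset.sum_congr rfl fun j _ => by ring
    change ∑ j, (e m * V m j) * (e n * V n j) = _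
    rw [h1]
    change (e m * e n) * (V m ⬝ᵥ V n) = _
    rw [h, Matrix.one_apply]
    split_ifs with hmn
    · subst hmn; simp [he]
    · simp
  · intro n
    have := hV0 n
    simp only [Pi.smul_apply, smul_eq_mul, e]
    split_ifs with h
    · simpa using h
    · have : V n ⟨0, hN⟩ < 0 := lt_of_le_of_ne (not_lt.mp h) this
      linarith
  · intro n
    have : (e n * V n ⟨0, hN⟩) ^ 2 = (V n ⟨0, hN⟩) ^ 2 := by
      rw [mul_pow, pow_two (e n), he, one_mul]
    simp only [Pi.smul_apply, smul_eq_mul, this]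
    rfl

/-- Spectral system: the columns of `U` are orthonormal and satisfy the three-term recurrence. -/
structure FavSys (N : ℕ) (x : Fin N → ℝ) (A S : ℕ → ℝ) (U : Fin N → ℕ → ℝ) : Prop where
  rec0 : ∀ n, x n * U n 0 = A 0 * U n 0 + S 0 * U n 1
  recS : ∀ k, k + 1 < N → ∀ n,
    x n * U n (k + 1) = S k * U n k + A (k + 1) * U n (k + 1) + S (k + 1) * U n (k + 2)
  orth : ∀ j k, j < N → k < N → ∑ n, U n j * U n k = if j = k then 1 else 0
  pos : ∀ k, k + 1 < N → 0 < S k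
  top : ∀ n k, N ≤ k → U n k = 0

lemma FavSys.orth' {N : ℕ} {x : Fin N → ℝ} {A S : ℕ → ℝ} {U : Fin N → ℕ → ℝ}
    (h : FavSys N x A S U) (j k : ℕ) (hj : j < N) (hjk : j ≠ k) : ∑ n, U n j * U n k = 0 := by
  by_cases hk : k < N
  · rw [h.orth j k hj hk, if_neg hjk]
  · apply Finset.sum_eq_zero
    intro n _
    rw [h.top n k (by omega), mul_zero]

lemma FavSys.A_eq {N : ℕ} {x : Fin N → ℝ} {A S : ℕ → ℝ} {U : Fin N → ℕ → ℝ}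
    (h : FavSys N x A S U) (k : ℕ) (hk : k < N) : A k = ∑ n, x n * (U n k) ^ 2 := by
  cases k with
  | zero =>
    have h1 : ∀ n, x n * (U n 0) ^ 2 = A 0 * (U n 0 * U n 0) + S 0 * (U n 0 * U n 1) := by
      intro n
      linear_combination (U n 0) * h.rec0 n
    simp only [h1, Finset.sum_add_distrib, ← Finset.mul_sum]
    rw [h.orth 0 0 hk hk, h.orth' 0 1 hk (by omega)]
    simp
  | succ k =>
    have h1 : ∀ n, x n * (U n (k + 1)) ^ 2 = S k * (U n (k + 1) * U n k)
        + A (k + 1) * (U n (k + 1) * U n (k + 1)) + S (k + 1) * (U n (k + 1) * U n (k + 2)) := by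
      intro n
      linear_combination (U n (k + 1)) * h.recS k hk n
    simp only [h1, Finset.sum_add_distrib, ← Finset.mul_sum]
    rw [h.orth _ _ hk hk, h.orth' (k + 1) (k + 2) hk (by omega),
      h.orth' (k + 1) k hk (by omega)]
    simp

lemma FavSys.norm_step {N : ℕ} {x : Fin N → ℝ} {A S A' S' : ℕ → ℝ} {U U' : Fin N → ℕ → ℝ}
    (h : FavSys N x A S U) (h' : FavSys N x A' S' U') (k : ℕ) (hk : k + 1 < N)
    (hh : ∀ n, S k * U n (k + 1) = S' k * U' n (k + 1)) :
    S k = S' k ∧ ∀ n, U n (k + 1) = U' n (k + 1) := by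
  have e1 : S k ^ 2 = S' k ^ 2 := by
    have h1 : ∑ n, (S k * U n (k + 1)) ^ 2 = S k ^ 2 := by
      have : ∀ n, (S k * U n (k + 1)) ^ 2 = S k ^ 2 * (U n (k + 1) * U n (k + 1)) := by
        intro n; ring
      simp only [this, ← Finset.mul_sum]
      rw [h.orth _ _ hk hk]; simp
    have h2 : ∑ n, (S' k * U' n (k + 1)) ^ 2 = S' k ^ 2 := by
      have : ∀ n, (S' k * U' n (k + 1)) ^ 2 = S' k ^ 2 * (U' n (k + 1) * U' n (k + 1)) := by
        intro n; ring
      simp only [this, ← Finset.mul_sum]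
      rw [h'.orth _ _ hk hk]; simp
    rw [← h1, ← h2]
    exact Finset.sum_congr rfl fun n _ => by rw [hh n]
  have p := h.pos k hk
  have p' := h'.pos k hk
  have e2 : S k = S' k := by
    rcases sq_eq_sq_iff_eq_or_eq_neg.mp e1 with h | h
    · exact h
    · linarith
  refine ⟨e2, fun n => ?_⟩
  have := hh n
  rw [← e2] at this
  exact mul_left_cancel₀ p.ne' this

lemma FavSys.uniq {N : ℕ} {x : Fin N → ℝ} {A S A' S' : ℕ → ℝ} {U U' : Fin N → ℕ → ℝ}
    (h : FavSys N x A S U) (h' : FavSys N x A' S' U') (h0 : ∀ n, U n 0 = U' n 0) (k : ℕ) :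
    k < N → (∀ n, U n k = U' n k) ∧ A k = A' k ∧
      (k + 1 < N → S k = S' k ∧ ∀ n, U n (k + 1) = U' n (k + 1)) := by
  induction k with
  | zero =>
    intro hk
    have hA : A 0 = A' 0 := by
      rw [h.A_eq 0 hk, h'.A_eq 0 hk]; simp only [h0]
    refine ⟨h0, hA, fun hk1 => h.norm_step h' 0 hk1 fun n => ?_⟩
    have r := h.rec0 n
    have r' := h'.rec0 n
    rw [h0, hA] at r
    simp only [zero_add]
    linarith
  | succ k ih =>
    intro hk
    obtain ⟨i1, i2, i3⟩ := ih (by omega)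
    obtain ⟨i3, i4⟩ := i3 hk
    have hA : A (k + 1) = A' (k + 1) := by
      rw [h.A_eq _ hk, h'.A_eq _ hk]; simp only [i4]
    refine ⟨i4, hA, fun hk1 => h.norm_step h' _ hk1 fun n => ?_⟩
    have r := h.recS k hk n
    have r' := h'.recS k hk n
    rw [i4, i3, hA, i1] at r
    linarith

lemma jacobi_favSys {N : ℕ} (hN : 0 < N) (a : Fin N → ℝ) (b : Fin (N - 1) → ℝ)
    (hb : ∀ i, 0 < b i) (x : Fin N → ℝ) (U : Matrix (Fin N) (Fin N) ℝ)
    (hU : ∀ n, jacobiMatrix a b *ᵥ U n = x n • U n) (hO : U * Uᵀ = 1) :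
    FavSys N x (favExt a) (fun k => Real.sqrt (favExt b k)) (fun n => favExt (U n)) := by
  have hO' : Uᵀ * U = 1 := mul_eq_one_comm.mp hO
  refine ⟨?_, ?_, ?_, ?_, ?_⟩
  · intro n
    have := jacobi_mulVec_zero a b (U n) hN
    rw [hU] at this
    rw [← this, favExt_lt _ hN]
    rfl
  · intro k hk n
    have := jacobi_mulVec_succ a b (U n) k hk
    rw [hU] at this
    rw [← this, favExt_lt _ hk]
    rfl
  · intro j k hj hk
    have := congrFun (congrFun hO' ⟨j, hj⟩) ⟨k, hk⟩
    rw [Matrix.mul_apply, Matrix.one_apply] at this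
    simp only [Fin.mk.injEq, Matrix.transpose_apply] at this
    rw [← this]
    exact Finset.sum_congr rfl fun n _ => by rw [favExt_lt _ hj, favExt_lt _ hk]
  · intro k hk
    rw [favExt_lt b (by omega)]
    exact Real.sqrt_pos.mpr (hb _)
  · intro n k hk
    exact favExt_ge _ hk

lemma spectral_inj {N : ℕ} (hN : 0 < N) (a a' : Fin N → ℝ) (b b' : Fin (N - 1) → ℝ)
    (hb : ∀ i, 0 < b i) (hb' : ∀ i, 0 < b' i) (hx : jacobiEigs a b = jacobiEigs a' b')
    (hw : ∀ n, jacobiWeights hN a b n = jacobiWeights hN a' b' n) : a = a' ∧ b = b' := by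
  obtain ⟨-, U, h1, h2, h3, h4⟩ := jacobi_spectral hN a b hb
  obtain ⟨-, U', h1', h2', h3', h4'⟩ := jacobi_spectral hN a' b' hb'
  have s := jacobi_favSys hN a b hb _ U h1 h2
  have s' := jacobi_favSys hN a' b' hb' _ U' h1' h2'
  rw [← hx] at s'
  have h0 : ∀ n, favExt (U n) 0 = favExt (U' n) 0 := by
    intro n
    rw [favExt_lt _ hN, favExt_lt _ hN]
    have e := hw n
    rw [h4, h4'] at e
    have p := h3 n
    have p' := h3' n
    rcases sq_eq_sq_iff_eq_or_eq_neg.mp e with h | h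
    · exact h
    · linarith
  have key := s.uniq s' h0
  constructor
  · ext i
    have := (key i i.isLt).2.1
    rwa [favExt_coe, favExt_coe] at this
  · ext i
    have hi := i.isLt
    have := ((key i (by omega)).2.2 (by omega)).1
    simp only [favExt_coe] at this
    exact (Real.sqrt_inj (hb i).le (hb' i).le).mp this

lemma weights_sum {N : ℕ} (hN : 0 < N) (a : Fin N → ℝ) (b : Fin (N - 1) → ℝ)
    (hb : ∀ i, 0 < b i) : ∑ n, jacobiWeights hN a b n = 1 := by
  obtain ⟨-, U, h1, h2, h3, h4⟩ := jacobi_spectral hN a b hb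
  have s := (jacobi_favSys hN a b hb _ U h1 h2).orth 0 0 hN hN
  simp only [if_true, favExt_lt _ hN] at s
  rw [← s]
  exact Finset.sum_congr rfl fun n _ => by rw [h4, pow_two]

/-- If `J` has a given orthonormal system of eigenvectors then its spectral data is as given. -/
lemma spectral_of_data {N : ℕ} (hN : 0 < N) (a : Fin N → ℝ) (b : Fin (N - 1) → ℝ)
    (hb : ∀ i, 0 < b i) (x : Fin N → ℝ) (hx : StrictAnti x) (U : Matrix (Fin N) (Fin N) ℝ)
    (hU : ∀ n, jacobiMatrix a b *ᵥ U n = x n • U n) (hO : U * Uᵀ = 1) :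
    jacobiEigs a b = x ∧ ∀ n, jacobiWeights hN a b n = (U n ⟨0, hN⟩) ^ 2 := by
  obtain ⟨hanti, V, h1, h2, h3, h4⟩ := jacobi_spectral hN a b hb
  have nrm : ∀ (W : Matrix (Fin N) (Fin N) ℝ), W * Wᵀ = 1 → ∀ n, W n ⬝ᵥ W n = 1 := by
    intro W hW n
    have := congrFun (congrFun hW n) n
    rw [Matrix.one_apply_eq] at this
    exact this
  have hsym : (jacobiMatrix a b)ᵀ = jacobiMatrix a b := by
    have := jacobiMatrix_isHermitian a b
    rwa [Matrix.IsHermitian, Matrix.conjTranspose_eq_transpose_of_trivial] at this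
  have hsub : Set.range x ⊆ Set.range (jacobiEigs a b) := by
    rintro _ ⟨n, rfl⟩
    by_contra hc
    have hz : ∀ m, V m ⬝ᵥ U n = 0 := by
      intro m
      have e : (jacobiMatrix a b *ᵥ V m) ⬝ᵥ U n = V m ⬝ᵥ (jacobiMatrix a b *ᵥ U n) := by
        rw [Matrix.dotProduct_mulVec, ← Matrix.mulVec_transpose, hsym]
      rw [h1, hU, smul_dotProduct, dotProduct_smul, smul_eq_mul, smul_eq_mul] at e
      have hne : jacobiEigs a b m ≠ x n := fun h => hc ⟨m, h⟩
      have : (jacobiEigs a b m - x n) * (V m ⬝ᵥ U n) = 0 := by linarith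
      exact (mul_eq_zero.mp this).resolve_left (sub_ne_zero.mpr hne)
    have hV : V *ᵥ U n = 0 := by
      ext m; exact hz m
    have hU0 : U n = 0 := by
      have : Vᵀ *ᵥ (V *ᵥ U n) = U n := by
        rw [Matrix.mulVec_mulVec, mul_eq_one_comm.mp h2, Matrix.one_mulVec]
      rw [← this, hV, Matrix.mulVec_zero]
    have := nrm U hO n
    rw [hU0] at this
    simp at this
  have hrange : Set.range (jacobiEigs a b) = Set.range x := by
    symm
    apply Set.eq_of_subset_of_ncard_le hsub
    · rw [← Set.image_univ, ← Set.image_univ, Set.ncard_image_of_injective _ hanti.injective,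
        Set.ncard_image_of_injective _ hx.injective]
    
  have hxe : jacobiEigs a b = x := by
    have m1 : StrictMono (fun n => - jacobiEigs a b n) := fun p q h => neg_lt_neg (hanti h)
    have m2 : StrictMono (fun n => - x n) := fun p q h => neg_lt_neg (hx h)
    have hr : Set.range (fun n => - jacobiEigs a b n) = Set.range (fun n => - x n) := by
      have e1 : (fun n => - jacobiEigs a b n) = Neg.neg ∘ jacobiEigs a b := rfl
      have e2 : (fun n => - x n) = Neg.neg ∘ x := rfl
      rw [e1, e2, Set.range_comp, Set.range_comp, hrange]
    have := (StrictMono.range_inj m1 m2).mp hr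
    ext n
    have := congrFun this n
    simpa using this
  refine ⟨hxe, fun n => ?_⟩
  have p := jacobi_eigvec_prop hN a b hb (V n) (U n) (x n) (by rw [h1, hxe]) (hU n)
  rw [h4]
  have e : (U n ⟨0, hN⟩) ^ 2 * (V n ⬝ᵥ V n) = (V n ⟨0, hN⟩) ^ 2 * (U n ⬝ᵥ U n) := by
    simp only [dotProduct, Finset.mul_sum]
    refine Finset.sum_congr rfl fun i _ => ?_
    linear_combination (U n ⟨0, hN⟩ * V n i + V n ⟨0, hN⟩ * U n i) * p i
  rw [nrm U hO, nrm V h2] at e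
  linarith

/-- Weighted inner product on functions on `Fin N`. -/
def favIP {N : ℕ} (w f g : Fin N → ℝ) : ℝ := ∑ n, w n * (f n * g n)

lemma favIP_comm {N : ℕ} (w f g : Fin N → ℝ) : favIP w f g = favIP w g f := by
  simp only [favIP, mul_comm]

lemma favIP_shift {N : ℕ} (w x f g : Fin N → ℝ) : favIP w f (x * g) = favIP w (x * f) g := by
  refine Finset.sum_congr rfl fun n _ => ?_
  simp only [Pi.mul_apply]
  ring

lemma favIP_comb {N : ℕ} (w f g p q : Fin N → ℝ) (s t : ℝ) :
    favIP w f (g + s • p + t • q) = favIP w f g + s * favIP w f p + t * favIP w f q := by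
  simp only [favIP, Finset.mul_sum, ← Finset.sum_add_distrib]
  refine Finset.sum_congr rfl fun n _ => ?_
  simp only [Pi.add_apply, Pi.smul_apply, smul_eq_mul]
  ring

lemma favIP_zero {N : ℕ} (w f : Fin N → ℝ) : favIP w f 0 = 0 := by
  simp [favIP]

/-- The Stieltjes recursion producing (values of) monic orthogonal polynomials:
the pair of consecutive members of the sequence. -/
def favSeq {N : ℕ} (w x : Fin N → ℝ) : ℕ → (Fin N → ℝ) × (Fin N → ℝ)
  | 0 => (0, 1)
  | k + 1 =>
    let p := favSeq w x k
    (p.2, x * p.2 + (-(favIP w p.2 (x * p.2) / favIP w p.2 p.2)) • p.2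
      + (-(favIP w p.2 p.2 / favIP w p.1 p.1)) • p.1)

def favG {N : ℕ} (w x : Fin N → ℝ) (k : ℕ) : Fin N → ℝ := (favSeq w x k).2
def favP {N : ℕ} (w x : Fin N → ℝ) (k : ℕ) : Fin N → ℝ := (favSeq w x k).1
def favH {N : ℕ} (w x : Fin N → ℝ) (k : ℕ) : ℝ := favIP w (favG w x k) (favG w x k)
def favAl {N : ℕ} (w x : Fin N → ℝ) (k : ℕ) : ℝ :=
  favIP w (favG w x k) (x * favG w x k) / favH w x k
def favBe {N : ℕ} (w x : Fin N → ℝ) (k : ℕ) : ℝ :=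
  favH w x k / favIP w (favP w x k) (favP w x k)

lemma favG_zero {N : ℕ} (w x : Fin N → ℝ) : favG w x 0 = 1 := rfl
lemma favP_zero {N : ℕ} (w x : Fin N → ℝ) : favP w x 0 = 0 := rfl
lemma favP_succ {N : ℕ} (w x : Fin N → ℝ) (k : ℕ) : favP w x (k + 1) = favG w x k := rfl
lemma favG_succ {N : ℕ} (w x : Fin N → ℝ) (k : ℕ) : favG w x (k + 1) =
    x * favG w x k + (-favAl w x k) • favG w x k + (-favBe w x k) • favP w x k := rfl
lemma favBe_succ {N : ℕ} (w x : Fin N → ℝ) (k : ℕ) :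
    favBe w x (k + 1) = favH w x (k + 1) / favH w x k := rfl

open Polynomial in
lemma favG_poly {N : ℕ} (w x : Fin N → ℝ) (k : ℕ) :
    ∃ p q : ℝ[X], p.Monic ∧ p.natDegree = k ∧ q.degree < p.degree ∧
      (∀ n, favG w x k n = p.eval (x n)) ∧ (∀ n, favP w x k n = q.eval (x n)) := by
  induction k with
  | zero => exact ⟨1, 0, monic_one, by simp, by simp, by simp [favG_zero], by simp [favP_zero]⟩
  | succ k ih =>
    obtain ⟨p, q, hp, hd, hq, h1, h2⟩ := ih
    set r := C (favBe w x k) * q with hr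
    have hrd : r.degree < p.degree :=
      lt_of_le_of_lt (by rw [hr, ← smul_eq_C_mul]; exact degree_smul_le _ _) hq
    have hm : ((X - C (favAl w x k)) * p).Monic := (monic_X_sub_C _).mul hp
    have hnd : ((X - C (favAl w x k)) * p).natDegree = k + 1 := by
      rw [(monic_X_sub_C _).natDegree_mul hp, natDegree_X_sub_C, hd, add_comm]
    have hlt : p.degree < ((X - C (favAl w x k)) * p).degree := by
      rw [degree_eq_natDegree hp.ne_zero, degree_eq_natDegree hm.ne_zero, hnd, hd]
      exact_mod_cast Nat.lt_succ_self k
    have hlt' := hrd.trans hlt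
    have hde := degree_sub_eq_left_of_degree_lt hlt'
    refine ⟨(X - C (favAl w x k)) * p - r, p, hm.sub_of_left hlt', ?_, ?_, ?_, ?_⟩
    · rw [natDegree_eq_of_degree_eq hde, hnd]
    · rw [hde]; exact hlt
    · intro n
      rw [favG_succ]
      simp only [Pi.add_apply, Pi.mul_apply, Pi.smul_apply, smul_eq_mul, h1, h2, hr, eval_sub,
        eval_mul, eval_X, eval_C]
      ring
    · intro n
      rw [favP_succ, h1]

open Polynomial in
lemma favH_pos {N : ℕ} (w x : Fin N → ℝ) (hw : ∀ n, 0 < w n) (hx : Function.Injective x)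
    (k : ℕ) (hk : k < N) : 0 < favH w x k := by
  have hnn : ∀ n ∈ Finset.univ, 0 ≤ w n * (favG w x k n * favG w x k n) := fun n _ =>
    mul_nonneg (hw n).le (mul_self_nonneg _)
  refine lt_of_le_of_ne (Finset.sum_nonneg hnn) fun h0 => ?_
  have h1 := (Finset.sum_eq_zero_iff_of_nonneg hnn).mp h0.symm
  obtain ⟨p, q, hp, hd, -, he, -⟩ := favG_poly w x k
  have : p = 0 := by
    apply eq_zero_of_natDegree_lt_card_of_eval_eq_zero p hx
    · intro n
      have := h1 n (Finset.mem_univ n)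
      rw [← he]
      simpa [(hw n).ne'] using this
    · rw [hd, Fintype.card_fin]; exact hk
  exact hp.ne_zero this

lemma favG_orth {N : ℕ} (w x : Fin N → ℝ) (hw : ∀ n, 0 < w n) (hx : Function.Injective x)
    (m : ℕ) : m ≤ N → ∀ j < m, favIP w (favG w x j) (favG w x m) = 0 := by
  induction m using Nat.strong_induction_on with
  | _ m ih =>
    intro hm j hj
    cases m with
    | zero => omega
    | succ k =>
      have hk := (favH_pos w x hw hx k (by omega)).ne'
      rw [favG_succ, favIP_comb]
      rcases Nat.lt_succ_iff_lt_or_eq.mp hj with hjk | rfl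
      · rw [ih k (by omega) (by omega) j hjk, favIP_shift]
        have hxg : x * favG w x j = favG w x (j + 1) + favAl w x j • favG w x j
            + favBe w x j • favP w x j := by
          rw [favG_succ]; module
        have hP : favIP w (favG w x k) (favP w x j) = 0 := by
          cases j with
          | zero => rw [favP_zero, favIP_zero]
          | succ i =>
            rw [favP_succ, favIP_comm]
            exact ih k (by omega) (by omega) i (by omega)
        rw [favIP_comm, hxg, favIP_comb, hP, favIP_comm w _ (favG w x j),
          ih k (by omega) (by omega) j hjk]
        cases k with
        | zero => omega
        | succ i =>
          rw [favP_succ, favBe_succ]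
          rcases Nat.lt_succ_iff_lt_or_eq.mp hjk with hji | rfl
          · rw [favIP_comm, ih (i + 1) (by omega) (by omega) (j + 1) (by omega),
              ih i (by omega) (by omega) j hji]
            ring
          · have hj' := (favH_pos w x hw hx j (by omega)).ne'
            change favH w x (j + 1) + _ + _ + _ + _ * favH w x j = 0
            field_simp
            ring
      · have hP : favIP w (favG w x j) (favP w x j) = 0 := by
          cases j with
          | zero => rw [favP_zero, favIP_zero]
          | succ i =>
            rw [favP_succ, favIP_comm]
            exact ih (i + 1) (by omega) (by omega) i (by omega)
        rw [hP]
        change _ + -(_ / favH w x j) * favH w x j + _ = 0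
        field_simp
        ring

/-- The inverse spectral construction. -/
lemma fav_exists {N : ℕ} (hN : 0 < N) (w x : Fin N → ℝ) (hw : ∀ n, 0 < w n)
    (hw1 : ∑ n, w n = 1) (hx : Function.Injective x) :
    ∃ (a : Fin N → ℝ) (b : Fin (N - 1) → ℝ) (U : Matrix (Fin N) (Fin N) ℝ),
      (∀ i, 0 < b i) ∧ (∀ n, jacobiMatrix a b *ᵥ U n = x n • U n) ∧ U * Uᵀ = 1 ∧
      ∀ n, (U n ⟨0, hN⟩) ^ 2 = w n := by
  have hH := favH_pos w x hw hx
  set G := favG w x with hG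
  set s : ℕ → ℝ := fun k => Real.sqrt (favH w x k) with hs
  have hs0 : ∀ k, k < N → 0 < s k := fun k hk => Real.sqrt_pos.mpr (hH k hk)
  have hss : ∀ k, k < N → s k * s k = favH w x k := fun k hk => Real.mul_self_sqrt (hH k hk).le
  let U : Matrix (Fin N) (Fin N) ℝ := fun n k => Real.sqrt (w n) * G k n / s k
  have hww : ∀ n, Real.sqrt (w n) * Real.sqrt (w n) = w n := fun n =>
    Real.mul_self_sqrt (hw n).le
  have hUU : Uᵀ * U = 1 := by
    ext i j
    rw [Matrix.mul_apply, Matrix.one_apply]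
    have e : ∑ n, Uᵀ i n * U n j = favIP w (G i) (G j) / (s i * s j) := by
      rw [favIP, Finset.sum_div]
      refine Finset.sum_congr rfl fun n _ => ?_
      have hi := (hs0 i i.isLt).ne'
      have hj := (hs0 j j.isLt).ne'
      change (Real.sqrt (w n) * G i n / s i) * (Real.sqrt (w n) * G j n / s j) = _
      rw [div_mul_div_comm]
      congr 1
      linear_combination (G i n * G j n) * hww n
    rw [e]
    split_ifs with hij
    · subst hij
      rw [hss i i.isLt]
      exact div_self (hH i i.isLt).ne'
    · have : favIP w (G i) (G j) = 0 := by
        rcases lt_or_gt_of_ne hij with h | h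
        · exact favG_orth w x hw hx j j.isLt.le i h
        · rw [favIP_comm]
          exact favG_orth w x hw hx i i.isLt.le j h
      rw [this, zero_div]
  have hUU' : U * Uᵀ = 1 := mul_eq_one_comm.mp hUU
  have hGN : ∀ n, G N n = 0 := by
    let v : Fin N → ℝ := fun n => Real.sqrt (w n) * G N n
    have h1 : Uᵀ *ᵥ v = 0 := by
      ext i
      have e : (Uᵀ *ᵥ v) i = favIP w (G i) (G N) / s i := by
        rw [favIP, Finset.sum_div]
        change ∑ n, (Real.sqrt (w n) * G i n / s i) * (Real.sqrt (w n) * G N n) = _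
        refine Finset.sum_congr rfl fun n _ => ?_
        linear_combination (G i n * G N n / s i) * hww n
      rw [e, favG_orth w x hw hx N le_rfl i i.isLt, zero_div]
      rfl
    have h2 : v = 0 := by
      have : U *ᵥ (Uᵀ *ᵥ v) = v := by
        rw [Matrix.mulVec_mulVec, hUU', Matrix.one_mulVec]
      rw [← this, h1, Matrix.mulVec_zero]
    intro n
    have h3 : Real.sqrt (w n) * G N n = 0 := congrFun h2 n
    exact (mul_eq_zero.mp h3).resolve_left (Real.sqrt_pos.mpr (hw n)).ne'
  let a : Fin N → ℝ := fun k => favAl w x k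
  let b : Fin (N - 1) → ℝ := fun k => favH w x (k + 1) / favH w x k
  have hup : ∀ n k, k < N → Real.sqrt (favExt b k) * favExt (U n) (k + 1)
      = Real.sqrt (w n) * G (k + 1) n / s k := by
    intro n k hk
    by_cases h : k + 1 < N
    · rw [favExt_lt b (by omega), favExt_lt _ h]
      change Real.sqrt (favH w x (k + 1) / favH w x k) *
        (Real.sqrt (w n) * G (k + 1) n / s (k + 1)) = _
      rw [Real.sqrt_div (hH _ h).le]
      change s (k + 1) / s k * _ = _
      have h1 := (hs0 k hk).ne'
      have h2 := (hs0 _ h).ne'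
      field_simp
    · have : k + 1 = N := by omega
      rw [this, hGN, favExt_ge (U n) le_rfl]
      simp
  have hdn : ∀ n k, k + 1 < N → Real.sqrt (favExt b k) * favExt (U n) k
      = Real.sqrt (w n) * (favBe w x (k + 1) * G k n) / s (k + 1) := by
    intro n k h
    rw [favExt_lt b (by omega), favExt_lt _ (by omega), favBe_succ, ← hss _ h,
      ← hss k (by omega)]
    change Real.sqrt (favH w x (k + 1) / favH w x k) * (Real.sqrt (w n) * G k n / s k) = _
    rw [Real.sqrt_div (hH _ h).le]
    change s (k + 1) / s k * _ = _
    have h1 := (hs0 k (by omega)).ne'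
    have h2 := (hs0 _ h).ne'
    field_simp
  refine ⟨a, b, U, ?_, ?_, hUU', ?_⟩
  · intro i
    have := i.isLt
    exact div_pos (hH _ (by omega)) (hH _ (by omega))
  · intro n
    ext ⟨k, hk⟩
    cases k with
    | zero =>
      rw [jacobi_mulVec_zero, hup n 0 hN, favExt_lt a hN, favExt_lt _ hN]
      change favAl w x 0 * (Real.sqrt (w n) * G 0 n / s 0) + _ =
        x n * (Real.sqrt (w n) * G 0 n / s 0)
      rw [hG, favG_succ, favP_zero]
      simp only [Pi.add_apply, Pi.mul_apply, Pi.smul_apply, smul_eq_mul, Pi.zero_apply]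
      ring
    | succ k =>
      rw [jacobi_mulVec_succ, hup n (k + 1) hk, hdn n k hk, favExt_lt a hk, favExt_lt _ hk]
      change _ + favAl w x (k + 1) * (Real.sqrt (w n) * G (k + 1) n / s (k + 1)) + _ =
        x n * (Real.sqrt (w n) * G (k + 1) n / s (k + 1))
      rw [hG, favG_succ w x (k + 1), favP_succ]
      simp only [Pi.add_apply, Pi.mul_apply, Pi.smul_apply, smul_eq_mul]
      ring
  · intro n
    have h0 : favH w x 0 = 1 := by
      simp [favH, favIP, favG_zero, hw1]
    change (Real.sqrt (w n) * favG w x 0 n / Real.sqrt (favH w x 0)) ^ 2 = _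
    rw [h0, favG_zero]
    simp [Real.sq_sqrt (hw n).le]

lemma sum_split_last {N : ℕ} (hN : 0 < N) (f : Fin N → ℝ) :
    ∑ n, f n = (∑ i : Fin (N - 1), f ⟨i, by have := i.isLt; omega⟩) + f ⟨N - 1, by omega⟩ := by
  obtain ⟨M, rfl⟩ : ∃ M, N = M + 1 := ⟨N - 1, by omega⟩
  exact Fin.sum_univ_castSucc f

/-- Favard's theorem for finitely supported measures. -/
theorem favard_bijection (N : ℕ) (hN : 2 ≤ N) :
    (∀ (a : Fin N → ℝ) (b : Fin (N - 1) → ℝ), (∀ i, 0 < b i) →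
      StrictAnti (jacobiEigs a b) ∧
      (∀ n, 0 < jacobiWeights (by omega) a b n) ∧
      ∑ n, jacobiWeights (by omega) a b n = 1) ∧
    Set.BijOn
      (fun p : (Fin N → ℝ) × (Fin (N - 1) → ℝ) => spectralMap (by omega) p.1 p.2)
      (Set.univ ×ˢ {b | ∀ i, 0 < b i}) (chamber N ×ˢ openSimplex N) := by
  have hN0 : 0 < N := by omega
  have hA : ∀ (a : Fin N → ℝ) (b : Fin (N - 1) → ℝ), (∀ i, 0 < b i) →
      StrictAnti (jacobiEigs a b) ∧
      (∀ n, 0 < jacobiWeights hN0 a b n) ∧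
      ∑ n, jacobiWeights hN0 a b n = 1 := by
    intro a b hb
    obtain ⟨h, U, -, -, h3, h4⟩ := jacobi_spectral hN0 a b hb
    refine ⟨h, fun n => ?_, weights_sum hN0 a b hb⟩
    rw [h4]
    exact pow_pos (h3 n) 2
  refine ⟨hA, ?_, ?_, ?_⟩
  · rintro ⟨a, b⟩ ⟨-, hb⟩
    obtain ⟨h1, h2, h3⟩ := hA a b hb
    refine ⟨fun i j hij => h1 hij, fun i => h2 _, ?_⟩
    rw [sum_split_last hN0] at h3
    have := h2 ⟨N - 1, by omega⟩
    change ∑ i : Fin (N - 1), jacobiWeights hN0 a b ⟨i, _⟩ < 1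
    linarith
  · rintro ⟨a, b⟩ ⟨-, hb⟩ ⟨a', b'⟩ ⟨-, hb'⟩ h
    obtain ⟨-, -, h3⟩ := hA a b hb
    obtain ⟨-, -, h3'⟩ := hA a' b' hb'
    have hx : jacobiEigs a b = jacobiEigs a' b' := congrArg Prod.fst h
    have hw : ∀ i : Fin (N - 1), jacobiWeights hN0 a b ⟨i, by have := i.isLt; omega⟩ =
        jacobiWeights hN0 a' b' ⟨i, by have := i.isLt; omega⟩ := fun i =>
      congrFun (congrArg Prod.snd h) i
    rw [sum_split_last hN0] at h3 h3'
    simp only [hw] at h3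
    obtain ⟨e1, e2⟩ := spectral_inj hN0 a a' b b' hb hb' hx (by
      rintro ⟨n, hn⟩
      by_cases hn1 : n < N - 1
      · exact hw ⟨n, hn1⟩
      · obtain rfl : n = N - 1 := by omega
        linarith)
    rw [e1, e2]
  · rintro ⟨x, w⟩ ⟨hx, hw, hw1⟩
    have hxa : StrictAnti x := fun i j hij => hx i j hij
    have hlt : ∀ i : Fin (N - 1), wExt (N := N) w ⟨i, by have := i.isLt; omega⟩ = w i := by
      intro i
      simp [wExt]
    have hlast : wExt (N := N) w ⟨N - 1, by omega⟩ = 1 - ∑ i, w i := by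
      simp [wExt]
    have hpos : ∀ n, 0 < wExt (N := N) w n := by
      rintro ⟨n, hn⟩
      by_cases hn1 : n < N - 1
      · rw [hlt ⟨n, hn1⟩]
        exact hw _
      · obtain rfl : n = N - 1 := by omega
        rw [hlast]
        change ∑ i, w i < 1 at hw1
        linarith
    have hsum : ∑ n, wExt (N := N) w n = 1 := by
      rw [sum_split_last hN0, hlast]
      simp only [hlt]
      ring
    obtain ⟨a, b, U, hb, hU, hO, h0⟩ := fav_exists hN0 (wExt w) x hpos hsum hxa.injective
    obtain ⟨e1, e2⟩ := spectral_of_data hN0 a b hb x hxa U hU hO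
    refine ⟨(a, b), ⟨Set.mem_univ _, hb⟩, ?_⟩
    refine Prod.ext e1 ?_
    ext i
    change jacobiWeights hN0 a b ⟨i, _⟩ = w i
    rw [e2, h0, hlt]
end
end

section
/- Fix an integer N ≥ 2 and define the moment map φ : ℝ^N_> × S_N → ℝ^{2N−1} by φ(x_1,…,x_N, w_1,…,w_{N−1}) = (m_1,…,m_{2N−1}), where m_k = Σ_{n=1}^N w_n x_n^k and w_N = 1 − Σ_{n=1}^{N−1} w_n. Then φ is injective, continuously differentiable on the open set ℝ^N_> × S_N, and at every point of this set the absolute value of the determinant of its derivative (as a linear map ℝ^{2N−1} → ℝ^{2N−1}) equals |Δ(x_1,…,x_N)|⁴ ∏_{n=1}^N w_n. In particular the image M = φ(ℝ^N_> × S_N) is open in ℝ^{2N−1} and φ is a C¹-diffeomorphism onto M. -/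
open MeasureTheory ProbabilityTheory Matrix Finset Real
open scoped ENNReal NNReal

noncomputable section

/-- The moment map from (nodes, weights) (rolled into a single vector of length
`2N - 1`: first the `N` nodes, then the first `N - 1` weights) to the moments
`m_1, …, m_{2N-1}`. -/
def momentMap (N : ℕ) (p : Fin (2 * N - 1) → ℝ) : Fin (2 * N - 1) → ℝ :=
  fun k => ∑ n : Fin N, wExt (wPart p) n * xPart p n ^ ((k : ℕ) + 1)

/-- The set of rolled-up vectors whose node part is strictly decreasing and whose
weight part lies in the open simplex. -/
def nodeWeightDom (N : ℕ) : Set (Fin (2 * N - 1) → ℝ) :=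
  {p | xPart p ∈ chamber N ∧ wPart p ∈ openSimplex N}

/-! ### Auxiliary facts -/

lemma mm_prod_derivative {M : ℕ} (x : Fin (M+1) → ℝ) :
    ∏ n, |(Polynomial.derivative (Lagrange.nodal Finset.univ x)).eval (x n)| = |vdm x| ^ 2 := by
  have h1 : ∀ n, (Polynomial.derivative (Lagrange.nodal Finset.univ x)).eval (x n)
      = ∏ j ∈ ({n}ᶜ : Finset (Fin (M+1))), (x n - x j) := by
    intro n
    rw [Lagrange.eval_nodal_derivative_eval_node_eq (Finset.mem_univ n), Lagrange.eval_nodal]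
    congr 1
    ext j; simp
  simp_rw [h1, Finset.abs_prod]
  have := Finset.prod_prod_Ioi_mul_eq_prod_prod_off_diag (fun i j : Fin (M+1) => |x j - x i|)
  rw [← this, vdm, Finset.abs_prod, ← Finset.prod_pow]
  refine Finset.prod_congr rfl fun i _ => ?_
  rw [Finset.abs_prod, ← Finset.prod_pow]
  refine Finset.prod_congr rfl fun j _ => ?_
  rw [abs_sub_comm (x i) (x j), sq]

lemma mm_vdm_last {M : ℕ} (x : Fin (M+1) → ℝ) :
    |vdm x| = (∏ n : Fin M, |x n.castSucc - x (Fin.last M)|) *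
      |vdm (fun n : Fin M => x n.castSucc)| := by
  unfold vdm
  rw [Fin.prod_univ_castSucc, abs_mul, Finset.abs_prod, Finset.abs_prod]
  have h0 : Finset.Ioi (Fin.last M) = ∅ := by
    ext j; simp [Fin.le_last]
  rw [h0, Finset.prod_empty, mul_one, Finset.abs_prod, ← Finset.prod_mul_distrib]
  refine Finset.prod_congr rfl fun i _ => ?_
  have h1 : Finset.Ioi i.castSucc =
      Finset.cons (Fin.last M) ((Finset.Ioi i).map Fin.castSuccEmb) (by simp) := by
    ext j
    refine Fin.lastCases ?_ (fun j => ?_) j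
    · simp
    · simp
      intro _; exact Fin.le_last _
  rw [h1, Finset.prod_cons, abs_mul, Finset.prod_map, abs_sub_comm]
  rfl

lemma mm_functional {M : ℕ} (x w a b : Fin (M+1) → ℝ) (ha : ∑ n, a n = 0)
    (q : Polynomial ℝ) (hq : q.natDegree < 2 * (M+1) - 1 + 1) :
    ∑ k : Fin (2 * (M+1) - 1), q.coeff (k+1) *
      (∑ n, (a n * x n ^ ((k:ℕ)+1) + w n * ((((k:ℕ):ℝ)+1) * x n ^ (k:ℕ) * b n)))
      = ∑ n, (a n * q.eval (x n) + w n * (q.derivative.eval (x n) * b n)) := by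
  have h1 : ∀ t : ℝ, q.eval t = q.coeff 0 +
      ∑ k : Fin (2 * (M+1) - 1), q.coeff (k+1) * t ^ ((k:ℕ)+1) := by
    intro t
    rw [Polynomial.eval_eq_sum_range' hq, Finset.sum_range_succ', Finset.sum_range, add_comm]
    simp
  have h2 : ∀ t : ℝ, q.derivative.eval t =
      ∑ k : Fin (2 * (M+1) - 1), q.coeff (k+1) * ((((k:ℕ):ℝ)+1) * t ^ (k:ℕ)) := by
    intro t
    have : q.derivative.natDegree < 2 * (M+1) - 1 :=
      lt_of_le_of_lt (Polynomial.natDegree_derivative_le q) (by omega)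
    rw [Polynomial.eval_eq_sum_range' this, Finset.sum_range]
    refine Finset.sum_congr rfl fun k _ => ?_
    rw [Polynomial.coeff_derivative]; ring
  have h3 : ∀ n, a n * q.eval (x n) + w n * (q.derivative.eval (x n) * b n) = a n * q.coeff 0 +
      ∑ k : Fin (2 * (M+1) - 1), q.coeff (k+1) *
        (a n * x n ^ ((k:ℕ)+1) + w n * ((((k:ℕ):ℝ)+1) * x n ^ (k:ℕ) * b n)) := by
    intro n
    rw [h1, h2, mul_add, Finset.mul_sum, Finset.sum_mul, Finset.mul_sum, add_assoc,
      ← Finset.sum_add_distrib]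
    congr 1
    refine Finset.sum_congr rfl fun k _ => ?_
    ring
  simp_rw [h3]
  rw [Finset.sum_add_distrib, ← Finset.sum_mul, ha, zero_mul, zero_add, Finset.sum_comm]
  refine Finset.sum_congr rfl fun k _ => ?_
  rw [Finset.mul_sum]

/-- row polynomials -/
def mmPoly {M : ℕ} (x : Fin (M+1) → ℝ) (l : ℕ) : Polynomial ℝ :=
  if l < M then (Polynomial.X - Polynomial.C (x (Fin.last M))) * Polynomial.X ^ l
  else Lagrange.nodal Finset.univ x * Polynomial.X ^ (l - M)

lemma mmPoly_monic {M : ℕ} (x : Fin (M+1) → ℝ) (l : ℕ) : (mmPoly x l).Monic := by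
  unfold mmPoly
  split_ifs
  · exact (Polynomial.monic_X_sub_C _).mul (Polynomial.monic_X_pow _)
  · exact Lagrange.nodal_monic.mul (Polynomial.monic_X_pow _)

lemma mmPoly_natDegree {M : ℕ} (x : Fin (M+1) → ℝ) (l : ℕ) : (mmPoly x l).natDegree = l + 1 := by
  unfold mmPoly
  split_ifs
  · rw [(Polynomial.monic_X_sub_C _).natDegree_mul (Polynomial.monic_X_pow _)]
    simp; omega
  · rw [Lagrange.nodal_monic.natDegree_mul (Polynomial.monic_X_pow _), Lagrange.natDegree_nodal]
    simp; omega

lemma mm_det {M : ℕ} (x w : Fin (M+1) → ℝ)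
    (J : Matrix (Fin (2 * (M+1) - 1)) (Fin (2 * (M+1) - 1)) ℝ)
    (a b : Fin (2 * (M+1) - 1) → Fin (M+1) → ℝ)
    (hJ : ∀ k j, J k j = ∑ n, (a j n * x n ^ ((k:ℕ)+1) +
      w n * ((((k:ℕ):ℝ)+1) * x n ^ (k:ℕ) * b j n)))
    (hb : ∀ j n, b j n = if (j:ℕ) = n then 1 else 0)
    (ha : ∀ j (n : Fin M), a j n.castSucc = if (j:ℕ) = M + 1 + n then 1 else 0)
    (ha' : ∀ j, a j (Fin.last M) = if (j:ℕ) < M + 1 then 0 else -1) :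
    |J.det| = |vdm x| ^ 4 * ∏ n, |w n| := by
  classical
  have hsum : ∀ j, ∑ n, a j n = 0 := by
    intro j
    rw [Fin.sum_univ_castSucc, ha']
    simp_rw [ha]
    split_ifs with h
    · rw [add_zero]; apply Finset.sum_eq_zero; intro n _; rw [if_neg]; omega
    · rw [Finset.sum_eq_single ⟨(j:ℕ) - (M+1), by have := j.isLt; omega⟩]
      · rw [if_pos]; · ring
        · simp; omega
      · intro n _ hn; rw [if_neg]; intro h'; apply hn; ext; simp; omega
      · simp
  let L : Matrix (Fin (2 * (M+1) - 1)) (Fin (2 * (M+1) - 1)) ℝ :=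
    Matrix.of fun l k => (mmPoly x l).coeff (k+1)
  have hL : L.det = 1 := by
    rw [Matrix.det_of_isLowerTriangular]
    · apply Finset.prod_eq_one
      intro l _
      have := (mmPoly_monic x l).coeff_natDegree
      rwa [mmPoly_natDegree] at this
    · intro i j hij
      have hij' : (i:ℕ) < j := by simpa using hij
      refine Polynomial.coeff_eq_zero_of_natDegree_lt (p := mmPoly x i) ?_
      rw [mmPoly_natDegree]
      omega
  have hLJ : ∀ l j, (L * J) l j = ∑ n, (a j n * (mmPoly x l).eval (x n) +
      w n * ((mmPoly x l).derivative.eval (x n) * b j n)) := by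
    intro l j
    rw [Matrix.mul_apply]
    simp_rw [hJ]
    exact mm_functional x w (a j) (b j) (hsum j) (mmPoly x l) (by rw [mmPoly_natDegree]; omega)
  have hdet : J.det = (L * J).det := by rw [Matrix.det_mul, hL, one_mul]
  let er : Fin M ⊕ Fin (M+1) ≃ Fin (2 * (M+1) - 1) :=
    finSumFinEquiv.trans (finCongr (by omega))
  let ec : Fin M ⊕ Fin (M+1) ≃ Fin (2 * (M+1) - 1) :=
    ((Equiv.sumComm _ _).trans finSumFinEquiv).trans (finCongr (by omega))
  have hin : ∀ (l : Fin (2 * (M+1) - 1)) (i : Fin M), (L * J) l (ec (Sum.inl i)) =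
      (mmPoly x l).eval (x i.castSucc) - (mmPoly x l).eval (x (Fin.last M)) := by
    intro l i
    have hv : ((ec (Sum.inl i) : Fin (2 * (M+1) - 1)) : ℕ) = M + 1 + i := by simp [ec]
    rw [hLJ, Fin.sum_univ_castSucc, ha', Finset.sum_eq_single i]
    · rw [ha, hb, hb, hv, if_pos rfl, if_neg, if_neg, if_neg]
      · ring
      · simp; try omega
      · omega
      · simp; try omega
    · intro n _ hn
      rw [ha, hb, hv, if_neg, if_neg]
      · ring
      · simp; omega
      · intro h; apply hn; ext; omega
    · simp
  have hinr : ∀ (l : Fin (2 * (M+1) - 1)) (i : Fin (M+1)), (L * J) l (ec (Sum.inr i)) =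
      w i * (mmPoly x l).derivative.eval (x i) := by
    intro l i
    have hv : ((ec (Sum.inr i) : Fin (2 * (M+1) - 1)) : ℕ) = i := by simp [ec]
    have ha0 : ∀ n, a (ec (Sum.inr i)) n = 0 := by
      intro n
      refine Fin.lastCases ?_ (fun n => ?_) n
      · rw [ha', if_pos]; rw [hv]; exact i.isLt
      · rw [ha, if_neg]; rw [hv]; have := i.isLt; omega
    rw [hLJ, Finset.sum_eq_single i]
    · rw [ha0, hb, hv, if_pos rfl]; ring
    · intro n _ hn
      rw [ha0, hb, hv, if_neg]
      · ring
      · intro h; apply hn; ext; omega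
    · simp
  let B : Matrix (Fin M) (Fin M) ℝ :=
    Matrix.of fun l i => (x i.castSucc - x (Fin.last M)) * x i.castSucc ^ (l:ℕ)
  let D : Matrix (Fin (M+1)) (Fin (M+1)) ℝ := Matrix.of fun l i =>
    (w i * (Polynomial.derivative (Lagrange.nodal Finset.univ x)).eval (x i)) * x i ^ (l:ℕ)
  let A : Matrix (Fin M) (Fin (M+1)) ℝ := Matrix.of fun l i =>
    (L * J) (er (Sum.inl l)) (ec (Sum.inr i))
  have hblock : (L * J).submatrix er ec = Matrix.fromBlocks B A 0 D := by
    have hnod : ∀ i, (Lagrange.nodal Finset.univ x).eval (x i) = 0 := fun i =>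
      Lagrange.eval_nodal_at_node (Finset.mem_univ i)
    ext l j
    rcases l with l | l <;> rcases j with j | j
    · have hv : ((er (Sum.inl l) : Fin (2 * (M+1) - 1)) : ℕ) = l := by simp [er]
      rw [Matrix.submatrix_apply, hin, hv]
      simp [mmPoly, B]
    · rfl
    · have hv : ((er (Sum.inr l) : Fin (2 * (M+1) - 1)) : ℕ) = M + l := by simp [er]
      rw [Matrix.submatrix_apply, hin, hv]
      simp [mmPoly, hnod]
    · have hv : ((er (Sum.inr l) : Fin (2 * (M+1) - 1)) : ℕ) = M + l := by simp [er]
      rw [Matrix.submatrix_apply, hinr, hv]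
      simp [mmPoly, hnod, D, Polynomial.derivative_mul]
      ring
  have hB : |B.det| = |vdm x| := by
    have : B = Matrix.of fun l i => (x i.castSucc - x (Fin.last M)) *
        (Matrix.vandermonde (fun n : Fin M => x n.castSucc))ᵀ l i := by
      ext l i; simp [B, Matrix.vandermonde_apply]
    rw [this, Matrix.det_mul_row, Matrix.det_transpose, Matrix.det_vandermonde, abs_mul,
      Finset.abs_prod, mm_vdm_last]
    rfl
  have hD : |D.det| = |vdm x| ^ 3 * ∏ n, |w n| := by
    have : D = Matrix.of fun l i => (w i * (Polynomial.derivative (Lagrange.nodal Finset.univ x)).eval (x i)) *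
        (Matrix.vandermonde x)ᵀ l i := by
      ext l i; simp [D, Matrix.vandermonde_apply]
    rw [this, Matrix.det_mul_row, Matrix.det_transpose, Matrix.det_vandermonde, abs_mul,
      Finset.abs_prod]
    simp_rw [abs_mul]
    rw [Finset.prod_mul_distrib, mm_prod_derivative]
    change _ * |vdm x| = _
    ring
  rw [hdet, ← Matrix.abs_det_submatrix_equiv_equiv er ec, hblock, Matrix.det_fromBlocks_zero₂₁,
    abs_mul, hB, hD]
  ring

/-- derivative of the extended weights -/
def mmDW (M : ℕ) (n : Fin (M+1)) : (Fin (2 * (M+1) - 1) → ℝ) →L[ℝ] ℝ :=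
  if h : (n : ℕ) < M then
    ContinuousLinearMap.proj (R := ℝ) (φ := fun _ : Fin (2 * (M+1) - 1) => ℝ)
      ⟨M + 1 + n, by omega⟩
  else - ∑ i : Fin M, ContinuousLinearMap.proj (R := ℝ)
    (φ := fun _ : Fin (2 * (M+1) - 1) => ℝ) ⟨M + 1 + i, by have := i.isLt; omega⟩

lemma mm_hasFDerivAt_w (M : ℕ) (n : Fin (M+1)) (p : Fin (2 * (M+1) - 1) → ℝ) :
    HasFDerivAt (fun p : Fin (2 * (M+1) - 1) → ℝ => wExt (N := M+1) (wPart p) n)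
      (mmDW M n) p := by
  unfold mmDW wExt wPart
  by_cases h : (n : ℕ) < M
  · have h' : (n : ℕ) < M + 1 - 1 := h
    simp only [h, h', dite_true]
    exact hasFDerivAt_apply _ _
  · have h' : ¬ (n : ℕ) < M + 1 - 1 := h
    simp only [h, h', dite_false]
    refine HasFDerivAt.const_sub ?_ 1
    exact HasFDerivAt.fun_sum fun i _ => hasFDerivAt_apply (𝕜 := ℝ) _ p

lemma mm_hasFDerivAt (M : ℕ) (p : Fin (2 * (M+1) - 1) → ℝ) :
    HasFDerivAt (momentMap (M+1))
      (ContinuousLinearMap.pi fun k : Fin (2 * (M+1) - 1) => ∑ n : Fin (M+1),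
        (wExt (N := M+1) (wPart p) n • (((k:ℕ)+1) • (xPart (N := M+1) p n) ^ (k:ℕ)) •
          ContinuousLinearMap.proj (R := ℝ) (φ := fun _ : Fin (2 * (M+1) - 1) => ℝ)
            (⟨n, by omega⟩ : Fin (2 * (M+1) - 1))
          + (xPart (N := M+1) p n) ^ ((k:ℕ)+1) • mmDW M n)) p := by
  rw [hasFDerivAt_pi]
  intro k
  refine HasFDerivAt.fun_sum fun n _ => ?_
  refine (mm_hasFDerivAt_w M n p).mul ?_
  have h0 : HasFDerivAt (fun p : Fin (2 * (M+1) - 1) → ℝ => xPart (N := M+1) p n)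
      (ContinuousLinearMap.proj (R := ℝ) (φ := fun _ : Fin (2 * (M+1) - 1) => ℝ)
            (⟨n, by omega⟩ : Fin (2 * (M+1) - 1))) p := hasFDerivAt_apply _ _
  exact h0.pow ((k:ℕ)+1)

lemma mm_contDiff (M : ℕ) : ContDiff ℝ 1 (momentMap (M+1)) := by
  rw [contDiff_pi]
  intro k
  refine ContDiff.sum fun n _ => ContDiff.mul ?_ (ContDiff.pow ?_ _)
  · unfold wExt wPart
    split_ifs
    · exact contDiff_apply _ _ _
    · exact contDiff_const.sub (ContDiff.sum fun i _ => contDiff_apply _ _ _)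
  · exact contDiff_apply _ _ _

lemma mm_jacobian (M : ℕ) (p : Fin (2 * (M+1) - 1) → ℝ) :
    |LinearMap.det (fderiv ℝ (momentMap (M+1)) p).toLinearMap|
        = |vdm (xPart (N := M+1) p)| ^ 4 * ∏ n, |wExt (N := M+1) (wPart p) n| := by
  rw [(mm_hasFDerivAt M p).fderiv, ← LinearMap.det_toMatrix']
  refine mm_det (xPart (N := M+1) p) (wExt (N := M+1) (wPart p)) _
    (fun j n => mmDW M n (Pi.single j 1)) (fun j n => if (j:ℕ) = n then 1 else 0)
    ?_ (fun _ _ => rfl) ?_ ?_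
  · intro k j
    rw [LinearMap.toMatrix'_apply]
    simp only [ContinuousLinearMap.coe_coe, ContinuousLinearMap.pi_apply,
      ContinuousLinearMap.sum_apply, ContinuousLinearMap.add_apply,
      ContinuousLinearMap.smul_apply, ContinuousLinearMap.proj_apply, smul_eq_mul, nsmul_eq_mul]
    refine Finset.sum_congr rfl fun n _ => ?_
    have : (Pi.single j (1:ℝ) : Fin (2 * (M+1) - 1) → ℝ) ⟨n, by omega⟩ =
        if (j:ℕ) = n then 1 else 0 := by
      simp [Pi.single_apply, Fin.ext_iff, eq_comm]
    rw [this]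
    push_cast
    ring
  · intro j n
    have : ((n.castSucc : Fin (M+1)) : ℕ) < M := n.isLt
    simp only [mmDW, this, dite_true, ContinuousLinearMap.proj_apply]
    simp [Pi.single_apply, Fin.ext_iff, eq_comm]
  · intro j
    simp only [mmDW, Fin.val_last, lt_irrefl, dite_false, ContinuousLinearMap.neg_apply,
      ContinuousLinearMap.sum_apply, ContinuousLinearMap.proj_apply]
    simp only [Pi.single_apply, Fin.ext_iff]
    split_ifs with h
    · rw [neg_eq_zero]; apply Finset.sum_eq_zero; intro n _; rw [if_neg]; omega
    · rw [Finset.sum_eq_single ⟨(j:ℕ) - (M+1), by have := j.isLt; omega⟩]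
      · rw [if_pos]
        simp; omega
      · intro n _ hn; rw [if_neg]; intro h'; apply hn; ext; simp; omega
      · simp

lemma mm_wExt_pos {M : ℕ} {w : Fin (M + 1 - 1) → ℝ} (hw : w ∈ openSimplex (M+1))
    (n : Fin (M+1)) : 0 < wExt (N := M+1) w n := by
  unfold wExt
  split_ifs with h
  · exact hw.1 _
  · linarith [hw.2]

lemma mm_wExt_sum {M : ℕ} (w : Fin (M + 1 - 1) → ℝ) :
    ∑ n, wExt (N := M+1) w n = 1 := by
  rw [Fin.sum_univ_castSucc]
  have h1 : wExt (N := M+1) w (Fin.last M) = 1 - ∑ i, w i := by simp [wExt]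
  have h2 : ∀ n : Fin M, wExt (N := M+1) w n.castSucc = w n := by
    intro n; simp [wExt]
  simp_rw [h1, h2]
  change ∑ i : Fin M, w i + (1 - ∑ i : Fin M, w i) = 1
  ring

lemma mm_vdm_ne {N : ℕ} {x : Fin N → ℝ} (hx : x ∈ chamber N) : vdm x ≠ 0 := by
  unfold vdm
  refine Finset.prod_ne_zero_iff.2 fun i _ => Finset.prod_ne_zero_iff.2 fun j hj => ?_
  exact sub_ne_zero.2 (hx i j (Finset.mem_Ioi.1 hj)).ne

lemma mm_isOpen (N : ℕ) : IsOpen (nodeWeightDom N) := by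
  have : nodeWeightDom N = (⋂ i : Fin N, ⋂ j : Fin N, ⋂ _ : i < j, {p | xPart p j < xPart p i}) ∩
      ((⋂ i, {p | 0 < wPart p i}) ∩ {p | ∑ i, wPart (N := N) p i < 1}) := by
    ext p; simp [nodeWeightDom, chamber, openSimplex]
  rw [this]
  unfold xPart wPart
  refine IsOpen.inter ?_ (IsOpen.inter ?_ ?_)
  · refine isOpen_iInter_of_finite fun i => isOpen_iInter_of_finite fun j =>
      isOpen_iInter_of_finite fun _ => isOpen_lt (continuous_apply _) (continuous_apply _)
  · exact isOpen_iInter_of_finite fun i => isOpen_lt continuous_const (continuous_apply _)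
  · exact isOpen_lt (continuous_finsetSum _ fun i _ => continuous_apply _) continuous_const

lemma mm_moments {M : ℕ} {p p' : Fin (2 * (M+1) - 1) → ℝ}
    (h : momentMap (M+1) p = momentMap (M+1) p') (q : Polynomial ℝ)
    (hq : q.natDegree < 2 * (M+1) - 1 + 1) :
    ∑ n, wExt (N := M+1) (wPart p) n * q.eval (xPart p n) =
      ∑ n, wExt (N := M+1) (wPart p') n * q.eval (xPart p' n) := by
  have key : ∀ p : Fin (2 * (M+1) - 1) → ℝ,
      ∑ n, wExt (N := M+1) (wPart p) n * q.eval (xPart p n) =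
      q.coeff 0 + ∑ k : Fin (2 * (M+1) - 1), q.coeff (k+1) * momentMap (M+1) p k := by
    intro p
    simp_rw [Polynomial.eval_eq_sum_range' hq, Finset.sum_range_succ', Finset.sum_range, mul_add,
      Finset.sum_add_distrib]
    rw [add_comm]
    congr 1
    · simp_rw [pow_zero, mul_one, ← Finset.sum_mul]
      rw [mm_wExt_sum, one_mul]
    · simp_rw [momentMap, Finset.mul_sum]
      rw [Finset.sum_comm]
      refine Finset.sum_congr rfl fun k _ => Finset.sum_congr rfl fun n _ => ?_
      ring
  rw [key, key, h]

lemma mm_strictAnti {N : ℕ} {x : Fin N → ℝ} (hx : x ∈ chamber N) : StrictAnti x :=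
  fun i j h => hx i j h

/-- test polynomial -/
def mmTest {M : ℕ} (x y : Fin (M+1) → ℝ) (s : ℝ) : Polynomial ℝ :=
  ∏ t ∈ (Finset.univ.image x ∪ Finset.univ.image y).erase s, (Polynomial.X - Polynomial.C t)

lemma mmTest_deg {M : ℕ} (x y : Fin (M+1) → ℝ) (n : Fin (M+1)) :
    (mmTest x y (x n)).natDegree < 2 * (M+1) - 1 + 1 := by
  unfold mmTest
  rw [Polynomial.natDegree_finsetProd_X_sub_C_eq_card]
  have hmem : x n ∈ Finset.univ.image x ∪ Finset.univ.image y := by simp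
  have h1 := Finset.card_erase_lt_of_mem hmem
  have h2 := Finset.card_union_le (Finset.univ.image x) (Finset.univ.image y)
  have h3 : (Finset.univ.image x).card ≤ M + 1 := by
    simpa using Finset.card_image_le (s := Finset.univ) (f := x)
  have h4 : (Finset.univ.image y).card ≤ M + 1 := by
    simpa using Finset.card_image_le (s := Finset.univ) (f := y)
  omega

lemma mmTest_ne {M : ℕ} (x y : Fin (M+1) → ℝ) (s : ℝ) : (mmTest x y s).eval s ≠ 0 := by
  unfold mmTest
  rw [Polynomial.eval_prod]
  refine Finset.prod_ne_zero_iff.2 fun t ht => ?_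
  simpa [sub_eq_zero] using (Finset.ne_of_mem_erase ht).symm

lemma mmTest_zero {M : ℕ} (x y : Fin (M+1) → ℝ) (s t : ℝ) (hts : t ≠ s)
    (ht : t ∈ Set.range x ∨ t ∈ Set.range y) : (mmTest x y s).eval t = 0 := by
  unfold mmTest
  rw [Polynomial.eval_prod]
  refine Finset.prod_eq_zero (i := t) ?_ (by simp)
  rw [Finset.mem_erase]
  refine ⟨hts, ?_⟩
  simpa using ht

lemma mm_range {M : ℕ} {p p' : Fin (2 * (M+1) - 1) → ℝ}
    (hp : p ∈ nodeWeightDom (M+1))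
    (h : momentMap (M+1) p = momentMap (M+1) p') :
    Set.range (xPart (N := M+1) p) ⊆ Set.range (xPart (N := M+1) p') := by
  rintro _ ⟨n, rfl⟩
  by_contra hn
  have := mm_moments h _ (mmTest_deg (xPart p) (xPart p') n)
  rw [Finset.sum_eq_single n, Finset.sum_eq_zero] at this
  · exact mul_ne_zero (mm_wExt_pos hp.2 n).ne' (mmTest_ne _ _ _) this
  · intro m _
    rw [mmTest_zero, mul_zero]
    · intro h'; exact hn ⟨m, h'⟩
    · exact Or.inr ⟨m, rfl⟩
  · intro m _ hm
    rw [mmTest_zero, mul_zero]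
    · intro h'; exact hm ((mm_strictAnti hp.1).injective h')
    · exact Or.inl ⟨m, rfl⟩
  · simp

lemma mm_injOn (M : ℕ) : Set.InjOn (momentMap (M+1)) (nodeWeightDom (M+1)) := by
  intro p hp p' hp' h
  have hx : xPart (N := M+1) p = xPart (N := M+1) p' :=
    ((mm_strictAnti hp.1).range_inj (mm_strictAnti hp'.1)).1
      (Set.Subset.antisymm (mm_range hp h) (mm_range hp' h.symm))
  have hw : ∀ n, wExt (N := M+1) (wPart p) n = wExt (N := M+1) (wPart p') n := by
    intro n
    have := mm_moments h _ (mmTest_deg (xPart p) (xPart p') n)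
    rw [← hx] at this
    have hz : ∀ m, m ≠ n → (mmTest (xPart (N := M+1) p) (xPart p) (xPart p n)).eval (xPart p m) = 0 := by
      intro m hm
      rw [mmTest_zero]
      · intro h'; exact hm ((mm_strictAnti hp.1).injective h')
      · exact Or.inl ⟨m, rfl⟩
    rw [Finset.sum_eq_single n, Finset.sum_eq_single n] at this
    · exact mul_right_cancel₀ (mmTest_ne _ _ _) this
    · intro m _ hm; rw [hz m hm, mul_zero]
    · simp
    · intro m _ hm; rw [hz m hm, mul_zero]
    · simp
  funext j
  by_cases hj : (j:ℕ) < M + 1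
  · exact congrFun hx ⟨j, hj⟩
  · have h1 := hw ⟨(j:ℕ) - (M+1), by omega⟩
    have hlt : (j:ℕ) - (M+1) < M + 1 - 1 := by have := j.isLt; omega
    simp only [wExt, hlt, dite_true, wPart] at h1
    have hj' : (⟨M + 1 + ((j:ℕ) - (M+1)), by omega⟩ : Fin (2 * (M+1) - 1)) = j := by
      ext; simp; omega
    rwa [hj'] at h1

/-- the moment map is a C¹-diffeomorphism with the stated Jacobian. -/
theorem moment_map_diffeomorphism (N : ℕ) (hN : 2 ≤ N) :
    IsOpen (nodeWeightDom N) ∧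
    Set.InjOn (momentMap N) (nodeWeightDom N) ∧
    ContDiffOn ℝ 1 (momentMap N) (nodeWeightDom N) ∧
    (∀ p ∈ nodeWeightDom N,
      |LinearMap.det (fderiv ℝ (momentMap N) p).toLinearMap|
        = |vdm (xPart p)| ^ 4 * ∏ n, wExt (wPart p) n) ∧
    IsOpen (momentMap N '' nodeWeightDom N) ∧
    ∃ ψ : (Fin (2 * N - 1) → ℝ) → (Fin (2 * N - 1) → ℝ),
      ContDiffOn ℝ 1 ψ (momentMap N '' nodeWeightDom N) ∧
      (∀ p ∈ nodeWeightDom N, ψ (momentMap N p) = p) ∧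
      ∀ q ∈ momentMap N '' nodeWeightDom N, momentMap N (ψ q) = q := by
  obtain ⟨M, rfl⟩ : ∃ M, N = M + 1 := ⟨N - 1, by omega⟩
  have hopen := mm_isOpen (M+1)
  have hinj := mm_injOn M
  have hC := mm_contDiff M
  have hjac : ∀ p ∈ nodeWeightDom (M+1),
      |LinearMap.det (fderiv ℝ (momentMap (M+1)) p).toLinearMap|
        = |vdm (xPart (N := M+1) p)| ^ 4 * ∏ n, wExt (N := M+1) (wPart p) n := by
    intro p hp
    rw [mm_jacobian]
    congr 1
    exact Finset.prod_congr rfl fun n _ => abs_of_pos (mm_wExt_pos hp.2 n)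
  have hdet : ∀ p ∈ nodeWeightDom (M+1), (fderiv ℝ (momentMap (M+1)) p).det ≠ 0 := by
    intro p hp h0
    have h1 := hjac p hp
    have h2 : 0 < |vdm (xPart (N := M+1) p)| ^ 4 * ∏ n, wExt (N := M+1) (wPart p) n :=
      mul_pos (pow_pos (abs_pos.2 (mm_vdm_ne hp.1)) 4)
        (Finset.prod_pos fun n _ => mm_wExt_pos hp.2 n)
    rw [← h1] at h2
    exact (abs_pos.1 h2) h0
  have hF : ∀ p (hp : p ∈ nodeWeightDom (M+1)), HasStrictFDerivAt (momentMap (M+1))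
      (((fderiv ℝ (momentMap (M+1)) p).toContinuousLinearEquivOfDetNeZero (hdet p hp) :
        (Fin (2 * (M+1) - 1) → ℝ) ≃L[ℝ] (Fin (2 * (M+1) - 1) → ℝ)) :
        (Fin (2 * (M+1) - 1) → ℝ) →L[ℝ] (Fin (2 * (M+1) - 1) → ℝ)) p := by
    intro p hp
    rw [ContinuousLinearMap.coe_toContinuousLinearEquivOfDetNeZero]
    exact hC.contDiffAt.hasStrictFDerivAt one_ne_zero
  have hmap : IsOpenMap ((nodeWeightDom (M+1)).domRestrict (momentMap (M+1))) := by
    rw [isOpenMap_iff_nhds_le]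
    rintro ⟨p, hp⟩
    have h1 := (hF p hp).map_nhds_eq_of_equiv
    change nhds (momentMap (M+1) p) ≤ _
    rw [← h1, ← map_nhds_subtype_coe_eq_nhds hp (hopen.mem_nhds hp), Filter.map_map]
    exact le_rfl
  let e : OpenPartialHomeomorph (Fin (2 * (M+1) - 1) → ℝ) (Fin (2 * (M+1) - 1) → ℝ) :=
    OpenPartialHomeomorph.ofContinuousOpenRestrict
      (hinj.toPartialEquiv (momentMap (M+1)) (nodeWeightDom (M+1)))
      hC.continuous.continuousOn hmap hopen
  have het : e.target = momentMap (M+1) '' nodeWeightDom (M+1) := rfl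
  refine ⟨hopen, hinj, hC.contDiffOn, hjac, ?_, e.symm, ?_, ?_, ?_⟩
  · rw [← het]; exact e.open_target
  · rw [← het]
    intro q hq
    have hs : e.symm q ∈ nodeWeightDom (M+1) := e.map_target hq
    exact (e.contDiffAt_symm hq (hF _ hs).hasFDerivAt hC.contDiffAt).contDiffWithinAt
  · intro p hp
    exact e.left_inv hp
  · intro q hq
    exact e.right_inv hq
end
end
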